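/- Let μ be a nonnegative finite Radon measure on Ω ⊆ ℝⁿ, x₀ ∈ Ω, and suppose μ(B(x₀, t)) ≤ C t^m for all t ∈ (0, 3r₀), where m ∈ (0, n-p) and B(x₀, 3r₀) ⊆ Ω, and p ∈ [2, n). Then for every ε > 0 there exist a set E ⊆ Ω which is p-thin for singular behavior at x₀ and a constant C' > 0 such that W^μ_{1,p}(x, r₀) ≤ C' |x-x₀|^{-(n-p-m+ε)/(p-1)} for all x ∈ Ω \ E. -/

import Mathlib

open MeasureTheory Metric Set Filter
open scoped ENNReal NNReal Topology

noncomputable section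

/-- Euclidean n-space. -/
abbrev Euc (n : ℕ) := EuclideanSpace ℝ (Fin n)

/-- The Wolff potential `W^μ_{1,p}(x, r) = ∫₀^r (μ(B(x,t))/t^{n-p})^{1/(p-1)} dt/t`. -/
def wolffPotential (n : ℕ) (p : ℝ) (μ : Measure (Euc n)) (x : Euc n) (r : ℝ) : ℝ≥0∞ :=
  ∫⁻ t in Set.Ioo (0 : ℝ) r,
    (μ (Metric.ball x t) / ENNReal.ofReal (t ^ ((n : ℝ) - p))) ^ (1 / (p - 1)) *
      ENNReal.ofReal t⁻¹

/-- The variational `p`-capacity of a compact set `K` inside `Ω`: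
`cap_p(K,Ω) = inf {∫_Ω |∇u|^p : u ∈ C₀^∞(Ω), u ≥ 1 on K}`. -/
def varCapCompact (n : ℕ) (p : ℝ) (K Ω : Set (Euc n)) : ℝ≥0∞ :=
  sInf {c | ∃ u : Euc n → ℝ, ContDiff ℝ (⊤ : ℕ∞) u ∧ HasCompactSupport u ∧ tsupport u ⊆ Ω ∧
    (∀ x ∈ K, 1 ≤ u x) ∧ c = ∫⁻ x in Ω, ENNReal.ofReal (‖fderiv ℝ u x‖ ^ p)}

/-- The variational `p`-capacity of an arbitrary set `E ⊆ Ω`, extended in the standard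
way: `cap_p(E,Ω) = inf_{open G ⊇ E, G ⊆ Ω} sup_{compact K ⊆ G} cap_p(K,Ω)`. -/
def varCap (n : ℕ) (p : ℝ) (E Ω : Set (Euc n)) : ℝ≥0∞ :=
  ⨅ G ∈ {G : Set (Euc n) | IsOpen G ∧ E ⊆ G ∧ G ⊆ Ω},
    ⨆ K ∈ {K : Set (Euc n) | IsCompact K ∧ K ⊆ G}, varCapCompact n p K Ω

/-- The dyadic annulus `ω_i(x₀) = {x : 2^{-i} ≤ |x-x₀| ≤ 2^{-i+1}}`. -/
def wAnn (n : ℕ) (i : ℕ) (x₀ : Euc n) : Set (Euc n) :=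
  {x | ‖x - x₀‖ ∈ Set.Icc ((2 : ℝ) ^ (-(i : ℤ))) ((2 : ℝ) ^ (-(i : ℤ) + 1))}

/-- The dyadic annulus `Ω_i(x₀) = {x : 2^{-i-1} ≤ |x-x₀| ≤ 2^{-i+2}}`. -/
def wAnnO (n : ℕ) (i : ℕ) (x₀ : Euc n) : Set (Euc n) :=
  {x | ‖x - x₀‖ ∈ Set.Icc ((2 : ℝ) ^ (-(i : ℤ) - 1)) ((2 : ℝ) ^ (-(i : ℤ) + 2))}

/-- `E` is `p`-thin for singular behavior at `x₀`: for `p ∈ (1, n)`,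
`Σ_{i≥1} cap_p(E ∩ ω_i(x₀), Ω_i(x₀)) / cap_p(∂B(x₀,2^{-i}), B(x₀,2^{-i+1})) < ∞`;
for `p = n`, `Σ_{i≥1} i^{n-1} cap_n(E ∩ ω_i(x₀), Ω_i(x₀)) < ∞`. -/
def pThinAt (n : ℕ) (p : ℝ) (E : Set (Euc n)) (x₀ : Euc n) : Prop :=
  if p < n then
    ∑' i : ℕ,
      varCap n p (E ∩ wAnn n (i + 1) x₀) (wAnnO n (i + 1) x₀) /
        varCap n p (Metric.sphere x₀ ((2 : ℝ) ^ (-(i : ℤ) - 1)))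
          (Metric.ball x₀ ((2 : ℝ) ^ (-(i : ℤ)))) < ⊤
  else
    ∑' i : ℕ, ((i + 1 : ℕ) : ℝ≥0∞) ^ ((n : ℝ) - 1) *
      varCap n n (E ∩ wAnn n (i + 1) x₀) (wAnnO n (i + 1) x₀) < ⊤

lemma lintegral_rpow_le_measure_univ_rpow_mul {α : Type*} [MeasurableSpace α] {μ : Measure α}
    {f : α → ℝ≥0∞} (hf : AEMeasurable f μ) {s : ℝ} (hs : 1 ≤ s) :
    (∫⁻ a, f a ∂μ) ^ s ≤ μ univ ^ (s - 1) * ∫⁻ a, f a ^ s ∂μ := by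
  have hs0 : 0 < s := by linarith
  have h := eLpNorm'_le_eLpNorm'_mul_rpow_measure_univ (μ := μ) (f := f) one_pos hs
    hf.aestronglyMeasurable
  simp only [eLpNorm', enorm_eq_self, ENNReal.rpow_one, div_one] at h
  calc (∫⁻ a, f a ∂μ) ^ s
      ≤ ((∫⁻ a, f a ^ s ∂μ) ^ (1 / s) * μ univ ^ (1 - 1 / s)) ^ s :=
        ENNReal.rpow_le_rpow h hs0.le
    _ = μ univ ^ (s - 1) * ∫⁻ a, f a ^ s ∂μ := by
        rw [ENNReal.mul_rpow_of_nonneg _ _ hs0.le, ← ENNReal.rpow_mul, ← ENNReal.rpow_mul,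
          one_div_mul_cancel hs0.ne', ENNReal.rpow_one, mul_comm]
        congr 2
        field_simp

lemma volume_ball_eq_ofReal_pow_mul {n : ℕ} (hn : 0 < n) (x : Euc n) {r : ℝ} (hr : 0 ≤ r) :
    volume (ball x r) = ENNReal.ofReal r ^ (n : ℝ) * volume (ball (0 : Euc n) 1) := by
  have : Nonempty (Fin n) := ⟨⟨0, hn⟩⟩
  rw [Measure.addHaar_ball _ _ hr, finrank_euclideanSpace_fin, ENNReal.ofReal_pow hr,
    ENNReal.rpow_natCast]

lemma one_le_lintegral_fderiv_of_meets_sphere {n : ℕ} {u : Euc n → ℝ} {x₀ e x : Euc n} {R : ℝ}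
    (hR : 0 < R) (he : ‖e‖ = 1) (hu : ContDiff ℝ (⊤ : ℕ∞) u)
    (hsupp : tsupport u ⊆ ball x₀ (2 * R)) (h1 : ∀ y ∈ sphere x₀ R, 1 ≤ u y)
    (hx : x ∈ ball x₀ (R / 2)) :
    1 ≤ ∫⁻ t in Icc (0 : ℝ) (4 * R), ‖fderiv ℝ u (x + t • e)‖ₑ := by
  have hx' : ‖x - x₀‖ < R / 2 := by rwa [mem_ball_iff_norm] at hx
  have hfar : ∀ t : ℝ, 0 ≤ t → t - R / 2 ≤ ‖x + t • e - x₀‖ := by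
    intro t ht
    have h2 : ‖t • e‖ = t := by rw [norm_smul, he, Real.norm_of_nonneg ht, mul_one]
    have h3 : t • e = (x + t • e - x₀) - (x - x₀) := by abel
    have h4 := norm_sub_le (x + t • e - x₀) (x - x₀)
    rw [← h3, h2] at h4
    linarith
  have hcont : ContinuousOn (fun t : ℝ => ‖x + t • e - x₀‖) (Icc 0 (2 * R)) := by fun_prop
  obtain ⟨t₁, ht₁, htR⟩ : R ∈ (fun t : ℝ => ‖x + t • e - x₀‖) '' Icc 0 (2 * R) := by
    apply intermediate_value_Icc (by linarith) hcont
    refine ⟨?_, ?_⟩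
    · simp only [zero_smul, add_zero]; linarith
    · have := hfar (2 * R) (by linarith)
      linarith
  have hv1 : 1 ≤ u (x + t₁ • e) := h1 _ (by simpa [mem_sphere_iff_norm] using htR)
  have hv0 : u (x + (4 * R) • e) = 0 := by
    by_contra hne
    have := hsupp (subset_tsupport u hne)
    rw [mem_ball_iff_norm] at this
    linarith [hfar (4 * R) (by linarith)]
  have hline : ∀ t : ℝ, HasDerivAt (fun t : ℝ => x + t • e) e t := fun t => by
    simpa using ((hasDerivAt_id t).smul_const e).const_add x
  have hd : ∀ t : ℝ, HasDerivAt (fun t : ℝ => u (x + t • e)) (fderiv ℝ u (x + t • e) e) t :=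
    fun t => ((hu.differentiable (by simp)) _).hasFDerivAt.comp_hasDerivAt t (hline t)
  have hc : ContDiff ℝ 1 (fun t : ℝ => u (x + t • e)) := by
    have : ContDiff ℝ 1 u := hu.of_le (by exact_mod_cast le_top)
    exact this.comp (by fun_prop)
  have hle := enorm_sub_le_lintegral_deriv_of_contDiffOn_Icc (a := t₁) (b := 4 * R)
    hc.contDiffOn (by linarith [ht₁.2])
  rw [hv0] at hle
  calc (1 : ℝ≥0∞) ≤ ‖0 - u (x + t₁ • e)‖ₑ := by
        rw [zero_sub, enorm_neg, Real.enorm_of_nonneg (by linarith)]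
        exact ENNReal.one_le_ofReal.2 hv1
    _ ≤ _ := hle
    _ ≤ ∫⁻ t in Icc t₁ (4 * R), ‖fderiv ℝ u (x + t • e)‖ₑ := by
        apply lintegral_mono
        intro t
        beta_reduce
        rw [(hd t).deriv]
        refine (ContinuousLinearMap.le_opENorm _ _).trans ?_
        rw [← ofReal_norm e, he]; simp
    _ ≤ _ := lintegral_mono_set (Icc_subset_Icc_left ht₁.1)

lemma volume_ball_le_mul_lintegral_fderiv {n : ℕ} (hn : 0 < n) {p : ℝ} (hp : 1 ≤ p)
    {u : Euc n → ℝ} {x₀ : Euc n} {R : ℝ} (hR : 0 < R) (hu : ContDiff ℝ (⊤ : ℕ∞) u)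
    (hsupp : tsupport u ⊆ ball x₀ (2 * R)) (h1 : ∀ y ∈ sphere x₀ R, 1 ≤ u y) :
    volume (ball x₀ (R / 2)) ≤ ENNReal.ofReal (4 * R) ^ p *
      ∫⁻ x in ball x₀ (2 * R), ENNReal.ofReal (‖fderiv ℝ u x‖ ^ p) := by
  have hp0 : 0 ≤ p := by linarith
  obtain ⟨e, he⟩ : ∃ e : Euc n, ‖e‖ = 1 := ⟨EuclideanSpace.single ⟨0, hn⟩ 1, by simp⟩
  have hfc : Continuous (fderiv ℝ u) := hu.continuous_fderiv (by simp)
  set F : Euc n → ℝ≥0∞ := fun x => ‖fderiv ℝ u x‖ₑ ^ p with hF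
  have hFm : Measurable F := (ENNReal.continuous_rpow_const.comp
    (continuous_enorm.comp hfc)).measurable
  have hF2 : ∀ x, ENNReal.ofReal (‖fderiv ℝ u x‖ ^ p) = F x := fun x => by
    rw [hF, ← ENNReal.ofReal_rpow_of_nonneg (norm_nonneg _) hp0, ofReal_norm]
  have hI : ∫⁻ x in ball x₀ (2 * R), ENNReal.ofReal (‖fderiv ℝ u x‖ ^ p) = ∫⁻ x, F x := by
    simp_rw [hF2]
    apply setLIntegral_eq_of_support_subset
    intro x hx
    apply hsupp
    apply support_fderiv_subset ℝ
    intro h0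
    apply hx
    have hp1 : 0 < p := by linarith
    simp [hF, h0, hp1, ← ofReal_norm]
  rw [hI]
  have hvol : (volume.restrict (Icc (0 : ℝ) (4 * R))) univ = ENNReal.ofReal (4 * R) := by simp
  have hpt : ∀ x ∈ ball x₀ (R / 2), 1 ≤ ENNReal.ofReal (4 * R) ^ (p - 1) *
      ∫⁻ t in Icc (0 : ℝ) (4 * R), F (x + t • e) := by
    intro x hx
    have h := one_le_lintegral_fderiv_of_meets_sphere hR he hu hsupp h1 hx
    have h2 := lintegral_rpow_le_measure_univ_rpow_mul
      (μ := volume.restrict (Icc (0 : ℝ) (4 * R))) (f := fun t => ‖fderiv ℝ u (x + t • e)‖ₑ)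
      (by
        apply Continuous.aemeasurable
        exact continuous_enorm.comp (hfc.comp (by fun_prop))) hp
    rw [hvol] at h2
    exact (ENNReal.one_le_rpow h (by linarith)).trans h2
  have hm : Measurable (fun z : Euc n × ℝ => F (z.1 + z.2 • e)) :=
    hFm.comp (by fun_prop)
  have hR4 : ENNReal.ofReal (4 * R) ^ p = ENNReal.ofReal (4 * R) ^ (p - 1) * ENNReal.ofReal (4 * R)
      := by
    have h0 : ENNReal.ofReal (4 * R) ≠ 0 := by simp; linarith
    conv_lhs => rw [show p = (p - 1) + 1 by ring]
    rw [ENNReal.rpow_add _ _ h0 ENNReal.ofReal_ne_top, ENNReal.rpow_one]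
  calc volume (ball x₀ (R / 2)) = ∫⁻ _ in ball x₀ (R / 2), 1 := by simp
    _ ≤ ∫⁻ x in ball x₀ (R / 2), ENNReal.ofReal (4 * R) ^ (p - 1) *
          ∫⁻ t in Icc (0 : ℝ) (4 * R), F (x + t • e) :=
        setLIntegral_mono' measurableSet_ball hpt
    _ = ENNReal.ofReal (4 * R) ^ (p - 1) *
          ∫⁻ t in Icc (0 : ℝ) (4 * R), ∫⁻ x in ball x₀ (R / 2), F (x + t • e) := by
        rw [lintegral_const_mul' _ _ (ENNReal.rpow_ne_top_of_nonneg (by linarith)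
          ENNReal.ofReal_ne_top), lintegral_lintegral_swap hm.aemeasurable]
    _ ≤ ENNReal.ofReal (4 * R) ^ (p - 1) *
          ∫⁻ t in Icc (0 : ℝ) (4 * R), ∫⁻ x, F x := by
        refine mul_le_mul_right (lintegral_mono fun t => ?_) _
        calc ∫⁻ x in ball x₀ (R / 2), F (x + t • e) ≤ ∫⁻ x, F (x + t • e) :=
              setLIntegral_le_lintegral _ _
          _ = ∫⁻ x, F x := lintegral_add_right_eq_self F (t • e)
    _ = _ := by
        rw [lintegral_const, hvol, hR4]; ring

lemma exists_pos_le_varCap_sphere {n : ℕ} (hn : 0 < n) {p : ℝ} (hp : 1 ≤ p) :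
    ∃ c : ℝ≥0∞, c ≠ 0 ∧ c ≠ ⊤ ∧ ∀ (x₀ : Euc n) (R : ℝ), 0 < R →
      c * ENNReal.ofReal R ^ ((n : ℝ) - p) ≤ varCap n p (sphere x₀ R) (ball x₀ (2 * R)) := by
  have hp0 : 0 ≤ p := by linarith
  set V := volume (ball (0 : Euc n) 1) with hV
  have hV0 : V ≠ 0 := (measure_ball_pos _ _ one_pos).ne'
  have hVt : V ≠ ⊤ := measure_ball_lt_top.ne
  have h4 : (ENNReal.ofReal 4 ^ p) ≠ ⊤ := ENNReal.rpow_ne_top_of_nonneg hp0 ENNReal.ofReal_ne_top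
  have h40 : (ENNReal.ofReal 4 ^ p) ≠ 0 := by simp
  have h20 : ENNReal.ofReal (1 / 2) ^ (n : ℝ) ≠ 0 := by
    simp
  have h2t : ENNReal.ofReal (1 / 2) ^ (n : ℝ) ≠ ⊤ :=
    ENNReal.rpow_ne_top_of_nonneg (by positivity) ENNReal.ofReal_ne_top
  refine ⟨(ENNReal.ofReal 4 ^ p)⁻¹ * (ENNReal.ofReal (1 / 2) ^ (n : ℝ) * V), ?_, ?_, ?_⟩
  · simp only [ne_eq, mul_eq_zero, ENNReal.inv_eq_zero, not_or]
    exact ⟨h4, h20, hV0⟩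
  · exact ENNReal.mul_ne_top (ENNReal.inv_ne_top.2 h40) (ENNReal.mul_ne_top h2t hVt)
  intro x₀ R hR
  have hR0 : ENNReal.ofReal R ≠ 0 := by simpa using hR
  have hRt : ENNReal.ofReal R ≠ ⊤ := ENNReal.ofReal_ne_top
  refine le_iInf₂ fun G hG => ?_
  refine le_trans ?_ (le_iSup₂ (f := fun K _ => varCapCompact n p K (ball x₀ (2 * R)))
    (sphere x₀ R) ⟨isCompact_sphere _ _, hG.2.1⟩)
  refine le_sInf ?_
  rintro c ⟨u, hu, -, hsupp, h1, rfl⟩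
  have h := volume_ball_le_mul_lintegral_fderiv hn hp hR hu hsupp h1
  rw [volume_ball_eq_ofReal_pow_mul hn _ (by linarith), div_eq_mul_one_div,
    ENNReal.ofReal_mul hR.le, ENNReal.ofReal_mul (by norm_num : (0 : ℝ) ≤ 4),
    ENNReal.mul_rpow_of_nonneg _ _ (by positivity), ENNReal.mul_rpow_of_nonneg _ _ hp0] at h
  set I := ∫⁻ x in ball x₀ (2 * R), ENNReal.ofReal (‖fderiv ℝ u x‖ ^ p)
  have hRp0 : ENNReal.ofReal R ^ p ≠ 0 := by simp [ENNReal.rpow_eq_zero_iff, hR]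
  have hRpt : ENNReal.ofReal R ^ p ≠ ⊤ := ENNReal.rpow_ne_top_of_nonneg hp0 hRt
  rw [ENNReal.rpow_sub _ _ hR0 hRt, ENNReal.div_eq_inv_mul]
  have h' : (ENNReal.ofReal 4 ^ p * ENNReal.ofReal R ^ p)⁻¹ *
      (ENNReal.ofReal R ^ (n : ℝ) * ENNReal.ofReal (1 / 2) ^ (n : ℝ) * V) ≤ I := by
    rw [← ENNReal.div_eq_inv_mul]
    exact ENNReal.div_le_of_le_mul' h
  rw [ENNReal.mul_inv (Or.inl h40) (Or.inl h4)] at h'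
  refine le_trans (le_of_eq ?_) h'
  ring

lemma ENNReal.add_rpow_le_rpow_add_mul_rpow_sub_one (x y : ℝ≥0∞) {p : ℝ} (hp : 1 ≤ p) :
    (x + y) ^ p ≤ x ^ p + ENNReal.ofReal p * (y * (x + y) ^ (p - 1)) := by
  have hp0 : 0 < p := by linarith
  have hpe : ENNReal.ofReal p ≠ 0 := by simpa using hp0
  rcases eq_or_ne x ⊤ with rfl | hx
  · simp [ENNReal.top_rpow_of_pos hp0]
  rcases eq_or_ne y ⊤ with rfl | hy
  · rcases hp.eq_or_lt with rfl | hp1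
    · simp
    · simp [ENNReal.top_rpow_of_pos hp0, ENNReal.top_rpow_of_pos (sub_pos.2 hp1),
        ENNReal.mul_top hpe]
  lift x to ℝ≥0 using hx
  lift y to ℝ≥0 using hy
  rcases eq_or_ne (x + y) 0 with h0 | h0
  · have hx0 : x = 0 := by simpa using (add_eq_zero.1 h0).1
    have hy0 : y = 0 := by simpa using (add_eq_zero.1 h0).2
    subst hx0 hy0
    simp [hp0]
  have key : ((x : ℝ) + y) ^ p ≤ (x : ℝ) ^ p + p * (y * ((x : ℝ) + y) ^ (p - 1)) := by
    have hs : (0 : ℝ) < x + y := by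
      have : 0 < x + y := pos_iff_ne_zero.2 h0
      exact_mod_cast this
    have hb := one_add_mul_self_le_rpow_one_add (s := -(y / ((x : ℝ) + y))) (by
      rw [neg_le_neg_iff, div_le_one hs]; simp) hp
    have he : 1 + -((y : ℝ) / ((x : ℝ) + y)) = x / (x + y) := by field_simp; ring
    rw [he, Real.div_rpow x.coe_nonneg hs.le] at hb
    have hsp : (0 : ℝ) < (x + y : ℝ) ^ p := Real.rpow_pos_of_pos hs p
    rw [le_div_iff₀ hsp] at hb
    have h1 : ((x : ℝ) + y) ^ p = (x + y) ^ (p - 1) * (x + y) := by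
      rw [← Real.rpow_add_one hs.ne']; simp
    have h2 : (1 + p * -((y : ℝ) / (x + y))) * (x + y) ^ p
        = (x + y) ^ p - p * (y * (x + y) ^ (p - 1)) := by
      rw [h1]; field_simp; ring
    linarith [h2 ▸ hb]
  have hpp : ENNReal.ofReal p = ((NNReal.mk p hp0.le : ℝ≥0) : ℝ≥0∞) := by
    rw [ENNReal.ofReal]; congr 1; exact Real.toNNReal_of_nonneg hp0.le
  rw [hpp, ← ENNReal.coe_add, ← ENNReal.coe_rpow_of_nonneg _ hp0.le,
    ← ENNReal.coe_rpow_of_nonneg _ hp0.le, ← ENNReal.coe_rpow_of_nonneg _ (sub_nonneg.2 hp)]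
  exact_mod_cast key

lemma ENNReal.exists_add_rpow_le {s : ℝ} (hs : 0 < s) {B : ℝ≥0∞} (hB : 1 < B) :
    ∃ C : ℝ≥0∞, C ≠ ⊤ ∧ 1 ≤ C ∧ ∀ x y : ℝ≥0∞, (x + y) ^ s ≤ B * x ^ s + C * y ^ s := by
  obtain ⟨c, hc1, hcB⟩ := exists_between hB
  have hct : c ≠ ⊤ := hcB.ne_top
  set η : ℝ≥0∞ := c ^ (1 / s) - 1 with hη
  have hc' : 1 < c ^ (1 / s) := ENNReal.one_lt_rpow hc1 (by positivity)
  have hη0 : η ≠ 0 := (tsub_pos_of_lt hc').ne'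
  have hηt : η ≠ ⊤ := ENNReal.sub_ne_top (ENNReal.rpow_ne_top_of_nonneg (by positivity) hct)
  have h1η : (1 + η) ^ s = c := by
    rw [hη, add_tsub_cancel_of_le hc'.le, ← ENNReal.rpow_mul, one_div_mul_cancel hs.ne',
      ENNReal.rpow_one]
  refine ⟨(η⁻¹ + 1) ^ s, ENNReal.rpow_ne_top_of_nonneg hs.le (by simp [hη0]),
    ENNReal.one_le_rpow (by simp) hs, fun x y => ?_⟩
  rcases le_total y (η * x) with h | h
  · calc (x + y) ^ s ≤ (x + η * x) ^ s := by gcongr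
      _ = c * x ^ s := by
        rw [← h1η, ← ENNReal.mul_rpow_of_nonneg _ _ hs.le]; ring_nf
      _ ≤ B * x ^ s := by gcongr
      _ ≤ _ := le_self_add
  · have hx : x ≤ η⁻¹ * y := by
      calc x = η⁻¹ * (η * x) := by
            rw [← mul_assoc, ENNReal.inv_mul_cancel hη0 hηt, one_mul]
        _ ≤ _ := by gcongr
    calc (x + y) ^ s ≤ (η⁻¹ * y + y) ^ s := by gcongr
      _ = (η⁻¹ + 1) ^ s * y ^ s := by
        rw [← ENNReal.mul_rpow_of_nonneg _ _ hs.le]; ring_nf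
      _ ≤ _ := le_add_self

lemma ENNReal.exists_sum_rpow_le {p : ℝ} (hp : 1 < p) {B : ℝ≥0∞} (hB : 1 < B) :
    ∃ C : ℝ≥0∞, C ≠ ⊤ ∧ ∀ (h : ℕ → ℝ≥0∞) (N : ℕ), (∑ k ∈ Finset.range N, h k) ^ p ≤
      C * ∑ k ∈ Finset.range N, ∑ j ∈ Finset.range (k + 1), B ^ (k - j) * (h k * h j ^ (p - 1)) := by
  obtain ⟨C, hC, hC1, hadd⟩ := ENNReal.exists_add_rpow_le (sub_pos.2 hp) hB
  have hs : ∀ (h : ℕ → ℝ≥0∞) (k : ℕ), (∑ j ∈ Finset.range k, h j) ^ (p - 1) ≤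
      C * ∑ j ∈ Finset.range k, B ^ (k - 1 - j) * h j ^ (p - 1) := by
    intro h k
    induction k with
    | zero => simp [sub_pos.2 hp]
    | succ k ih =>
      rw [Finset.sum_range_succ, Finset.sum_range_succ]
      refine (hadd _ _).trans ?_
      rw [mul_add]
      refine add_le_add ?_ ?_
      · refine (mul_le_mul_right ih B).trans_eq ?_
        rw [mul_left_comm, Finset.mul_sum]
        congr 1
        refine Finset.sum_congr rfl fun j hj => ?_
        have hj' := Finset.mem_range.1 hj
        rw [← mul_assoc, ← pow_succ']
        congr 2
        omega
      · simp
  refine ⟨ENNReal.ofReal p * C, ENNReal.mul_ne_top ENNReal.ofReal_ne_top hC, fun h N => ?_⟩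
  induction N with
  | zero => simp [show 0 < p by linarith]
  | succ N ih =>
    rw [Finset.sum_range_succ (fun k => h k), Finset.sum_range_succ (n := N), mul_add]
    refine (ENNReal.add_rpow_le_rpow_add_mul_rpow_sub_one _ _ hp.le).trans ?_
    refine add_le_add ?_ ?_
    · exact ih
    · rw [← Finset.sum_range_succ, mul_assoc]
      refine mul_le_mul_right ?_ _
      refine (mul_le_mul_right (hs h (N + 1)) (h N)).trans_eq ?_
      rw [mul_left_comm, Finset.mul_sum]
      congr 1
      refine Finset.sum_congr rfl fun j _ => ?_
      rw [mul_left_comm]; simp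

lemma measurableSet_setOf_dist_lt {n : ℕ} (s : ℝ) :
    MeasurableSet {z : Euc n × Euc n | dist z.2 z.1 < s} :=
  (isOpen_lt (by fun_prop) continuous_const).measurableSet

lemma measurable_measure_ball {n : ℕ} (ν : Measure (Euc n)) [SFinite ν] (s : ℝ) :
    Measurable fun x => ν (ball x s) :=
  measurable_measure_prodMk_left (measurableSet_setOf_dist_lt (n := n) s)

lemma measure_ball_eq_lintegral_indicator {n : ℕ} (ν : Measure (Euc n)) (x : Euc n) (s : ℝ) :
    ν (ball x s) = ∫⁻ y, {z : Euc n × Euc n | dist z.2 z.1 < s}.indicator 1 (x, y) ∂ν := by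
  rw [← lintegral_indicator_one measurableSet_ball]
  rfl

lemma setLIntegral_measure_ball_le {n : ℕ} (ν : Measure (Euc n)) [SFinite ν] (y : Euc n) (t s : ℝ) :
    ∫⁻ x in ball y t, ν (ball x s) ≤ volume (ball (0 : Euc n) s) * ν (ball y (t + s)) := by
  set S := {z : Euc n × Euc n | dist z.2 z.1 < s}
  have hS : MeasurableSet S := measurableSet_setOf_dist_lt s
  simp_rw [measure_ball_eq_lintegral_indicator ν _ s]
  rw [lintegral_lintegral_swap (by
    exact (measurable_one.indicator hS).aemeasurable)]
  calc ∫⁻ w, (∫⁻ x in ball y t, S.indicator 1 (x, w)) ∂ν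
      ≤ ∫⁻ w, (ball y (t + s)).indicator (fun _ => volume (ball (0 : Euc n) s)) w ∂ν := by
        refine lintegral_mono fun w => ?_
        by_cases hw : w ∈ ball y (t + s)
        · rw [indicator_of_mem hw]
          calc ∫⁻ x in ball y t, S.indicator 1 (x, w)
              ≤ ∫⁻ x, S.indicator 1 (x, w) := setLIntegral_le_lintegral _ _
            _ = ∫⁻ x, (ball w s).indicator 1 x := by
                refine lintegral_congr fun x => ?_
                by_cases h : dist w x < s
                · have h' : x ∈ ball w s := by rwa [mem_ball, dist_comm]
                  simp [S, h, h']
                · have h' : x ∉ ball w s := by rwa [mem_ball, dist_comm]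
                  simp [S, h, h']
            _ = volume (ball w s) := lintegral_indicator_one measurableSet_ball
            _ = _ := Measure.addHaar_ball_center _ _ _
        · rw [indicator_of_notMem hw]
          refine le_of_eq ((setLIntegral_congr_fun (g := fun _ => 0) measurableSet_ball
            fun x hx => indicator_of_notMem ?_ _).trans lintegral_zero)
          intro h
          apply hw
          have h1 : dist w x < s := h
          have h2 : dist x y < t := hx
          rw [mem_ball]
          linarith [dist_triangle w x y]
    _ = _ := by
        rw [lintegral_indicator measurableSet_ball, lintegral_const]
        simp

lemma setLIntegral_measure_ball_rpow_le {n : ℕ} (ν : Measure (Euc n)) [SFinite ν] (y : Euc n)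
    (t s : ℝ) {q : ℝ} (hq : 0 < q) (hq1 : q ≤ 1) :
    ∫⁻ x in ball y t, ν (ball x s) ^ q ≤
      volume (ball (0 : Euc n) t) ^ (1 - q) *
        (volume (ball (0 : Euc n) s) * ν (ball y (t + s))) ^ q := by
  have h := lintegral_rpow_le_measure_univ_rpow_mul (μ := volume.restrict (ball y t))
    (f := fun x => ν (ball x s) ^ q) ((measurable_measure_ball ν s).pow_const q).aemeasurable
    (s := 1 / q) (by rw [le_div_iff₀ hq]; linarith)
  simp_rw [← ENNReal.rpow_mul, mul_one_div_cancel hq.ne', ENNReal.rpow_one] at h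
  rw [Measure.restrict_apply_univ, Measure.addHaar_ball_center] at h
  have h2 := ENNReal.rpow_le_rpow h hq.le
  rw [← ENNReal.rpow_mul, one_div_mul_cancel hq.ne', ENNReal.rpow_one,
    ENNReal.mul_rpow_of_nonneg _ _ hq.le, ← ENNReal.rpow_mul] at h2
  refine h2.trans ?_
  have he : (1 / q - 1) * q = 1 - q := by field_simp
  rw [he]
  gcongr
  exact setLIntegral_measure_ball_le ν y t s

open scoped Convolution in
lemma exists_mollification {n : ℕ} (hn : 0 < n) :
    ∃ L : ℝ, 0 < L ∧ ∀ (r : ℝ), 0 < r → ∀ (α : Euc n → ℝ), Measurable α →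
      (∃ M : ℝ, ∀ x, |α x| ≤ M) → (∀ x, 0 ≤ α x) → ∃ A : Euc n → ℝ, ContDiff ℝ (⊤ : ℕ∞) A ∧
        (∀ x c, (∀ z ∈ ball x r, c ≤ α z) → c ≤ A x) ∧
        (∀ x, (∀ z ∈ ball x r, α z = 0) → A x = 0) ∧
        (∀ x c, (∀ z ∈ ball x r, α z ≤ c) → ‖fderiv ℝ A x‖ ≤ L / r * c) := by
  have : Nonempty (Fin n) := ⟨⟨0, hn⟩⟩
  set V : ℝ := volume.real (ball (0 : Euc n) 1) with hV
  have hV0 : 0 < V := ENNReal.toReal_pos (measure_ball_pos _ _ one_pos).ne' measure_ball_lt_top.ne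
  let f : ContDiffBump (0 : Euc n) := ⟨1 / 2, 1, by norm_num, by norm_num⟩
  have hfC : ContDiff ℝ (⊤ : ℕ∞) (f : Euc n → ℝ) := f.contDiff
  have hfs : HasCompactSupport (f : Euc n → ℝ) := f.hasCompactSupport
  obtain ⟨D, hD⟩ : ∃ D, ∀ x, ‖fderiv ℝ f x‖ ≤ D :=
    (hfs.fderiv ℝ).exists_bound_of_continuous (hfC.continuous_fderiv (by simp))
  have hD0 : 0 ≤ D := (norm_nonneg _).trans (hD 0)
  refine ⟨2 ^ n * (D + 1), by positivity, fun r hr α hαm hαb hα0 => ?_⟩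
  obtain ⟨M, hM⟩ := hαb
  have hM0 : 0 ≤ M := (abs_nonneg _).trans (hM 0)
  set κ : ℝ := 2 ^ n / (V * r ^ n) with hκ
  have hκ0 : 0 < κ := by positivity
  have hvolr : ∀ x : Euc n, ∀ s : ℝ, 0 ≤ s → volume.real (ball x s) = s ^ n * V := by
    intro x s hs
    rw [hV, Measure.real, Measure.addHaar_ball _ _ hs, ENNReal.toReal_mul,
      ENNReal.toReal_ofReal (by positivity), finrank_euclideanSpace_fin]
    rfl
  set φ : Euc n → ℝ := fun w => κ * f (r⁻¹ • w) with hφ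
  have hφC : ContDiff ℝ (⊤ : ℕ∞) φ := contDiff_const.mul (hfC.comp (by fun_prop))
  have hφ0 : ∀ w, 0 ≤ φ w := fun w => mul_nonneg hκ0.le f.nonneg
  have hφ1 : ∀ w ∈ ball (0 : Euc n) (r / 2), φ w = κ := by
    intro w hw
    rw [mem_ball_zero_iff] at hw
    have : f (r⁻¹ • w) = 1 := by
      apply f.one_of_mem_closedBall
      rw [mem_closedBall_zero_iff, norm_smul, norm_inv, Real.norm_of_nonneg hr.le, inv_mul_le_iff₀ hr]
      change _ ≤ r * (1 / 2)
      linarith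
    simp [hφ, this]
  have hφz : ∀ w ∉ ball (0 : Euc n) r, φ w = 0 := by
    intro w hw
    rw [mem_ball_zero_iff, not_lt] at hw
    have : f (r⁻¹ • w) = 0 := by
      apply f.zero_of_le_dist
      rw [dist_zero_right, norm_smul, norm_inv, Real.norm_of_nonneg hr.le]
      change 1 ≤ _
      rwa [le_inv_mul_iff₀ hr, mul_one]
    simp [hφ, this]
  have hφs : HasCompactSupport φ := HasCompactSupport.of_support_subset_isCompact
    (isCompact_closedBall (0 : Euc n) r) (fun w hw => by
      by_contra h
      exact hw (hφz w fun h' => h (ball_subset_closedBall h')))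
  have hdφ : ∀ w, ‖fderiv ℝ φ w‖ ≤ κ * (D / r) := by
    intro w
    have h1 : HasFDerivAt φ (κ • ((fderiv ℝ f (r⁻¹ • w)).comp
        (r⁻¹ • ContinuousLinearMap.id ℝ (Euc n)))) w := by
      have h2 : HasFDerivAt (f : Euc n → ℝ) (fderiv ℝ f (r⁻¹ • w)) (r⁻¹ • w) :=
        ((hfC.differentiable (by simp)) _).hasFDerivAt
      have h3 : HasFDerivAt (fun y : Euc n => r⁻¹ • y) (r⁻¹ • ContinuousLinearMap.id ℝ (Euc n)) w :=
        (hasFDerivAt_id w).const_smul r⁻¹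
      exact (h2.comp w h3).const_mul κ
    rw [h1.fderiv, norm_smul, Real.norm_of_nonneg hκ0.le]
    gcongr
    refine (ContinuousLinearMap.opNorm_comp_le _ _).trans ?_
    rw [norm_smul, norm_inv, Real.norm_of_nonneg hr.le, div_eq_mul_inv]
    gcongr
    · exact hD _
    · exact mul_le_of_le_one_right (by positivity) ContinuousLinearMap.norm_id_le
  have hdφz : ∀ w ∉ closedBall (0 : Euc n) r, fderiv ℝ φ w = 0 := by
    intro w hw
    by_contra hne
    apply hw
    have h2 : tsupport φ ⊆ closedBall 0 r := closure_minimal (fun w hw => by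
      by_contra h
      exact hw (hφz w fun h' => h (ball_subset_closedBall h'))) isClosed_closedBall
    exact h2 (support_fderiv_subset ℝ hne)
  have hαi : LocallyIntegrable α volume :=
    (memLp_top_of_bound hαm.aestronglyMeasurable M (ae_of_all _ hM)).locallyIntegrable le_top
  set ℓ := ContinuousLinearMap.mul ℝ ℝ
  have hconv : ∀ x, Integrable (fun t => φ t * α (x - t)) volume := fun x =>
    (hφs.convolutionExists_left ℓ hφC.continuous hαi x).integrable
  have hmem : ∀ x t : Euc n, t ∈ ball (0 : Euc n) r → x - t ∈ ball x r := by
    intro x t ht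
    rw [mem_ball_zero_iff] at ht
    rw [mem_ball_iff_norm]
    simpa using ht
  have hAx : ∀ x, (φ ⋆[ℓ, volume] α) x = ∫ t, φ t * α (x - t) := fun x => rfl
  refine ⟨φ ⋆[ℓ, volume] α, hφs.contDiff_convolution_left ℓ hφC hαi, ?_, ?_, ?_⟩
  · intro x c hc
    rw [hAx]
    rcases le_or_gt c 0 with hc0 | hc0
    · exact hc0.trans (integral_nonneg fun t => mul_nonneg (hφ0 t) (hα0 _))
    calc c = ∫ t in ball (0 : Euc n) (r / 2), κ * c := by
          rw [setIntegral_const, hvolr _ _ (by positivity), smul_eq_mul, hκ, div_pow]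
          field_simp
      _ ≤ ∫ t in ball (0 : Euc n) (r / 2), φ t * α (x - t) := by
          apply setIntegral_mono_on (integrableOn_const measure_ball_lt_top.ne)
            (hconv x).integrableOn measurableSet_ball
          intro t ht
          rw [hφ1 t ht]
          gcongr
          exact hc _ (hmem x t (ball_subset_ball (by linarith) ht))
      _ ≤ ∫ t, φ t * α (x - t) := setIntegral_le_integral (hconv x)
          (ae_of_all _ fun t => mul_nonneg (hφ0 t) (hα0 _))
  · intro x hx
    rw [hAx]
    refine integral_eq_zero_of_ae (ae_of_all _ fun t => ?_)
    by_cases ht : t ∈ ball (0 : Euc n) r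
    · simp [hx _ (hmem x t ht)]
    · simp [hφz t ht]
  · intro x c hc
    have hc0 : 0 ≤ c := (hα0 x).trans (hc x (mem_ball_self hr))
    rw [(hφs.hasFDerivAt_convolution_left ℓ (hφC.of_le (by exact_mod_cast le_top)) hαi x).fderiv]
    have hb : ∀ᵐ t ∂(volume : Measure (Euc n)),
        ‖(ℓ.precompL (Euc n)) (fderiv ℝ φ t) (α (x - t))‖ ≤
        (ball (0 : Euc n) r).indicator (fun _ => κ * (D / r) * c) t := by
      have hsph : volume (sphere (0 : Euc n) r) = 0 := Measure.addHaar_sphere _ _ _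
      filter_upwards [measure_eq_zero_iff_ae_notMem.1 hsph] with t ht
      by_cases hb : t ∈ ball (0 : Euc n) r
      · rw [indicator_of_mem hb]
        have he : (ℓ.precompL (Euc n)) (fderiv ℝ φ t) (α (x - t)) = α (x - t) • fderiv ℝ φ t := by
          ext v
          simp [ContinuousLinearMap.precompL_apply, ℓ, mul_comm]
        rw [he, norm_smul, Real.norm_of_nonneg (hα0 _), mul_comm]
        exact mul_le_mul (hdφ t) (hc _ (hmem x t hb)) (hα0 _) (by positivity)
      · rw [indicator_of_notMem hb, hdφz t (fun h => ?_)]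
        · simp
        · rw [← ball_union_sphere] at h
          exact h.elim hb ht
    refine (norm_integral_le_of_norm_le ?_ hb).trans ?_
    · exact (integrable_indicator_iff measurableSet_ball).2
        (integrableOn_const measure_ball_lt_top.ne)
    · rw [integral_indicator measurableSet_ball, setIntegral_const, hvolr _ _ hr.le, smul_eq_mul, hκ]
      have : r ^ n * V * (2 ^ n / (V * r ^ n) * (D / r) * c) = 2 ^ n * D / r * c := by
        field_simp
      rw [this]
      gcongr
      linarith

/-- The integrand of the Wolff potential at scale `r`, with the ball enlarged by the factor `c`. -/
def wolffDensity (n : ℕ) (p : ℝ) (ν : Measure (Euc n)) (c r : ℝ) (x : Euc n) : ℝ≥0∞ :=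
  (ν (ball x (c * r)) / ENNReal.ofReal r ^ ((n : ℝ) - p)) ^ (1 / (p - 1))

lemma measurable_wolffDensity {n : ℕ} {p : ℝ} (ν : Measure (Euc n)) [SFinite ν] (c r : ℝ) :
    Measurable (wolffDensity n p ν c r) :=
  ((measurable_measure_ball ν (c * r)).div_const _).pow_const _

lemma wolffDensity_eq {n : ℕ} {p : ℝ} (hp : 1 < p) (ν : Measure (Euc n)) (c r : ℝ) (x : Euc n) :
    wolffDensity n p ν c r x = (ENNReal.ofReal r ^ ((n : ℝ) - p))⁻¹ ^ (1 / (p - 1)) *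
      ν (ball x (c * r)) ^ (1 / (p - 1)) := by
  have : 0 ≤ 1 / (p - 1) := by have := sub_pos.2 hp; positivity
  rw [wolffDensity, ENNReal.div_eq_inv_mul, ENNReal.mul_rpow_of_nonneg _ _ this]

lemma inv_mul_wolffDensity_rpow {n : ℕ} {p : ℝ} (hp : 1 < p) (ν : Measure (Euc n)) (c : ℝ)
    {r : ℝ} (hr : 0 < r) (x : Euc n) :
    ((ENNReal.ofReal r)⁻¹ * wolffDensity n p ν c r x) ^ (p - 1) =
      (ENNReal.ofReal r ^ ((n : ℝ) - 1))⁻¹ * ν (ball x (c * r)) := by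
  have h1 : 0 < p - 1 := sub_pos.2 hp
  have hR0 : ENNReal.ofReal r ≠ 0 := by simpa using hr
  rw [wolffDensity, ENNReal.mul_rpow_of_nonneg _ _ h1.le, ← ENNReal.rpow_mul,
    one_div_mul_cancel h1.ne', ENNReal.rpow_one, ENNReal.div_eq_inv_mul, ← mul_assoc]
  congr 1
  rw [← ENNReal.rpow_neg_one, ← ENNReal.rpow_mul, ← ENNReal.rpow_neg, ← ENNReal.rpow_neg,
    ← ENNReal.rpow_add _ _ hR0 ENNReal.ofReal_ne_top]
  congr 1
  ring

lemma setLIntegral_inv_mul_wolffDensity_le {n : ℕ} (hn : 0 < n) {p : ℝ} (hp : 2 ≤ p)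
    (ν : Measure (Euc n)) [SFinite ν] {s r : ℝ} (hs : 0 < s) (hsr : s ≤ r) (y : Euc n) :
    ∫⁻ x in ball y (3 * r), (ENNReal.ofReal s)⁻¹ * wolffDensity n p ν 3 s x ≤
      (ENNReal.ofReal 3 ^ (n : ℝ) * volume (ball (0 : Euc n) 1)) *
        ((ENNReal.ofReal s / ENNReal.ofReal r) ^ (1 / (p - 1)) *
          (ENNReal.ofReal r ^ ((n : ℝ) - 1) * wolffDensity n p ν 6 r y)) := by
  have hr : 0 < r := hs.trans_le hsr
  have hp1 : 0 < p - 1 := by linarith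
  set q := 1 / (p - 1) with hq
  have hq0 : 0 < q := by positivity
  have hq1 : q ≤ 1 := by rw [hq, div_le_one hp1]; linarith
  have hpq : (p - 1) * q = 1 := mul_one_div_cancel hp1.ne'
  set S := ENNReal.ofReal s
  set R := ENNReal.ofReal r
  have hS0 : S ≠ 0 := by simpa [S] using hs
  have hR0 : R ≠ 0 := by simpa [R] using hr
  have hSt : S ≠ ⊤ := ENNReal.ofReal_ne_top
  have hRt : R ≠ ⊤ := ENNReal.ofReal_ne_top
  set W := ENNReal.ofReal 3 ^ (n : ℝ) * volume (ball (0 : Euc n) 1) with hW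
  have hW0 : W ≠ 0 := mul_ne_zero (by simp)
    (measure_ball_pos _ _ one_pos).ne'
  have hWt : W ≠ ⊤ := ENNReal.mul_ne_top (ENNReal.rpow_ne_top_of_nonneg (by positivity)
    ENNReal.ofReal_ne_top) measure_ball_lt_top.ne
  have hvol : ∀ t : ℝ, 0 < t → volume (ball (0 : Euc n) (3 * t)) = W * ENNReal.ofReal t ^ (n : ℝ) := by
    intro t ht
    rw [volume_ball_eq_ofReal_pow_mul hn _ (by positivity), ENNReal.ofReal_mul (by norm_num),
      ENNReal.mul_rpow_of_nonneg _ _ (by positivity), hW]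
    ring
  have hSid : S⁻¹ * (S ^ ((n : ℝ) - p))⁻¹ ^ q * (S ^ (n : ℝ)) ^ q = S ^ q := by
    rw [← ENNReal.rpow_neg_one, ← ENNReal.rpow_neg, ← ENNReal.rpow_mul, ← ENNReal.rpow_mul,
      ← ENNReal.rpow_add _ _ hS0 hSt, ← ENNReal.rpow_add _ _ hS0 hSt]
    congr 1
    linarith
  have hRid : (R ^ (n : ℝ)) ^ (1 - q) = (R⁻¹) ^ q * R ^ ((n : ℝ) - 1) * (R ^ ((n : ℝ) - p))⁻¹ ^ q := by
    rw [← ENNReal.rpow_neg_one, ← ENNReal.rpow_neg, ← ENNReal.rpow_mul, ← ENNReal.rpow_mul,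
      ← ENNReal.rpow_mul, ← ENNReal.rpow_add _ _ hR0 hRt, ← ENNReal.rpow_add _ _ hR0 hRt]
    congr 1
    linarith
  have hWid : W ^ (1 - q) * W ^ q = W := by
    rw [← ENNReal.rpow_add _ _ hW0 hWt]; simp
  have hc : S⁻¹ * (S ^ ((n : ℝ) - p))⁻¹ ^ q ≠ ⊤ := by
    refine ENNReal.mul_ne_top (ENNReal.inv_ne_top.2 hS0) (ENNReal.rpow_ne_top_of_nonneg hq0.le ?_)
    rw [ENNReal.inv_ne_top]
    exact (ENNReal.rpow_pos (pos_iff_ne_zero.2 hS0) hSt).ne'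
  calc ∫⁻ x in ball y (3 * r), S⁻¹ * wolffDensity n p ν 3 s x
      = S⁻¹ * (S ^ ((n : ℝ) - p))⁻¹ ^ q * ∫⁻ x in ball y (3 * r), ν (ball x (3 * s)) ^ q := by
        rw [← lintegral_const_mul' _ _ hc]
        refine lintegral_congr fun x => ?_
        rw [wolffDensity_eq (by linarith), mul_assoc]
    _ ≤ S⁻¹ * (S ^ ((n : ℝ) - p))⁻¹ ^ q * ((W * R ^ (n : ℝ)) ^ (1 - q) *
          (W * S ^ (n : ℝ) * ν (ball y (6 * r))) ^ q) := by
        refine mul_le_mul_right ?_ _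
        refine (setLIntegral_measure_ball_rpow_le ν y (3 * r) (3 * s) hq0 hq1).trans ?_
        rw [hvol r hr, hvol s hs]
        gcongr
        linarith
    _ = (S⁻¹ * (S ^ ((n : ℝ) - p))⁻¹ ^ q * (S ^ (n : ℝ)) ^ q) * (W ^ (1 - q) * W ^ q) *
          (R ^ (n : ℝ)) ^ (1 - q) * ν (ball y (6 * r)) ^ q := by
        rw [ENNReal.mul_rpow_of_nonneg _ _ (sub_nonneg.2 hq1), ENNReal.mul_rpow_of_nonneg _ _ hq0.le,
          ENNReal.mul_rpow_of_nonneg _ _ hq0.le]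
        ring
    _ = _ := by
        rw [hSid, hWid, hRid, wolffDensity_eq (by linarith), ENNReal.div_eq_inv_mul,
          ENNReal.mul_rpow_of_nonneg _ _ hq0.le]
        ring

lemma setLIntegral_wolffDensity_mul_rpow_le {n : ℕ} (hn : 0 < n) {p : ℝ} (hp : 2 ≤ p)
    (ν : Measure (Euc n)) [SFinite ν] {s r : ℝ} (hs : 0 < s) (hsr : s ≤ r) (D : Set (Euc n))
    (hD : MeasurableSet D) :
    ∫⁻ x in D, (ENNReal.ofReal s)⁻¹ * wolffDensity n p ν 3 s x *
        ((ENNReal.ofReal r)⁻¹ * wolffDensity n p ν 3 r x) ^ (p - 1) ≤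
      (ENNReal.ofReal 3 ^ (n : ℝ) * volume (ball (0 : Euc n) 1)) *
        (ENNReal.ofReal s / ENNReal.ofReal r) ^ (1 / (p - 1)) *
          ∫⁻ y, (thickening (3 * r) D).indicator (wolffDensity n p ν 6 r) y ∂ν := by
  have hr : 0 < r := hs.trans_le hsr
  set R := ENNReal.ofReal r
  have hR0 : R ≠ 0 := by simpa [R] using hr
  have hRt : R ≠ ⊤ := ENNReal.ofReal_ne_top
  have hRn0 : R ^ ((n : ℝ) - 1) ≠ 0 := (ENNReal.rpow_pos (pos_iff_ne_zero.2 hR0) hRt).ne'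
  have hRnt : R ^ ((n : ℝ) - 1) ≠ ⊤ := by
    simp [ENNReal.rpow_eq_top_iff, hR0, hRt]
  set W := ENNReal.ofReal 3 ^ (n : ℝ) * volume (ball (0 : Euc n) 1)
  set Q := (ENNReal.ofReal s / R) ^ (1 / (p - 1))
  have hWt : W ≠ ⊤ := ENNReal.mul_ne_top (ENNReal.rpow_ne_top_of_nonneg (by positivity)
    ENNReal.ofReal_ne_top) measure_ball_lt_top.ne
  have hQt : Q ≠ ⊤ := ENNReal.rpow_ne_top_of_nonneg
    (by have : 0 < p - 1 := by linarith
        positivity) (ENNReal.div_ne_top ENNReal.ofReal_ne_top hR0)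
  set g := fun x => (ENNReal.ofReal s)⁻¹ * wolffDensity n p ν 3 s x with hg
  have hgm : Measurable g := (measurable_wolffDensity ν 3 s).const_mul _
  set T := {z : Euc n × Euc n | dist z.2 z.1 < 3 * r} with hT
  have hTm : MeasurableSet T := measurableSet_setOf_dist_lt _
  have hFm : Measurable (fun z : Euc n × Euc n => T.indicator 1 z * g z.1 : _ → ℝ≥0∞) :=
    (measurable_one.indicator hTm).mul (hgm.comp measurable_fst)
  calc ∫⁻ x in D, g x * (R⁻¹ * wolffDensity n p ν 3 r x) ^ (p - 1)
      = ∫⁻ x in D, (R ^ ((n : ℝ) - 1))⁻¹ * ∫⁻ y, T.indicator 1 (x, y) * g x ∂ν := by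
        refine lintegral_congr fun x => ?_
        rw [inv_mul_wolffDensity_rpow (by linarith) ν 3 hr, measure_ball_eq_lintegral_indicator]
        have hm : Measurable fun y => T.indicator (1 : Euc n × Euc n → ℝ≥0∞) (x, y) :=
          (measurable_one.indicator hTm).comp measurable_prodMk_left
        rw [lintegral_mul_const (g x) hm]
        ring
    _ = (R ^ ((n : ℝ) - 1))⁻¹ * ∫⁻ y, (∫⁻ x in D, T.indicator 1 (x, y) * g x) ∂ν := by
        rw [lintegral_const_mul' _ _ (ENNReal.inv_ne_top.2 hRn0)]
        congr 1
        exact lintegral_lintegral_swap hFm.aemeasurable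
    _ ≤ (R ^ ((n : ℝ) - 1))⁻¹ * ∫⁻ y, W * Q * R ^ ((n : ℝ) - 1) *
          (thickening (3 * r) D).indicator (wolffDensity n p ν 6 r) y ∂ν := by
        refine mul_le_mul_right (lintegral_mono fun y => ?_) _
        by_cases hy : y ∈ thickening (3 * r) D
        · rw [indicator_of_mem hy]
          calc ∫⁻ x in D, T.indicator 1 (x, y) * g x
              ≤ ∫⁻ x, T.indicator 1 (x, y) * g x := setLIntegral_le_lintegral _ _
            _ = ∫⁻ x in ball y (3 * r), g x := by
                rw [← lintegral_indicator measurableSet_ball]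
                refine lintegral_congr fun x => ?_
                by_cases h : dist y x < 3 * r
                · have h' : x ∈ ball y (3 * r) := by rwa [mem_ball, dist_comm]
                  simp [T, h, h']
                · have h' : x ∉ ball y (3 * r) := by rwa [mem_ball, dist_comm]
                  simp [T, h, h']
            _ ≤ _ := setLIntegral_inv_mul_wolffDensity_le hn hp ν hs hsr y
            _ = _ := by ring
        · rw [indicator_of_notMem hy, mul_zero]
          refine le_of_eq ((setLIntegral_congr_fun (g := fun _ => 0) hD
            fun x hx => ?_).trans lintegral_zero)
          have : (x, y) ∉ T := fun h => hy (mem_thickening_iff.2 ⟨x, hx, h⟩)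
          simp [this]
    _ = _ := by
        rw [lintegral_const_mul' _ _ (ENNReal.mul_ne_top (ENNReal.mul_ne_top hWt hQt) hRnt),
          ← mul_assoc]
        congr 1
        rw [mul_comm (W * Q), ← mul_assoc, ENNReal.inv_mul_cancel hRn0 hRnt, one_mul]

lemma sum_indicator_wolffDensity_le {n : ℕ} {p : ℝ} (hp : 1 < p) (hpn : p < n)
    (ν : Measure (Euc n)) {ρ : ℝ} (hρ : 0 < ρ)
    (hν : ν univ ≤ ENNReal.ofReal ρ ^ ((n : ℝ) - p)) (N : ℕ) (D : Set (Euc n))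
    (hD : ∀ x ∈ D, ∑ k ∈ Finset.range N, wolffDensity n p ν 1 (ρ / 2 ^ k) x ≤ 1) (y : Euc n) :
    ∑ j ∈ Finset.range N,
        (thickening (3 * (ρ / 2 ^ j)) D).indicator (wolffDensity n p ν 6 (ρ / 2 ^ j)) y ≤
      5 * 16 ^ (((n : ℝ) - p) * (1 / (p - 1))) := by
  set q := 1 / (p - 1) with hq
  have hp1 : 0 < p - 1 := by linarith
  have hq0 : 0 < q := by positivity
  have hs0 : 0 < (n : ℝ) - p := by linarith
  set T : ℝ≥0∞ := 16 ^ (((n : ℝ) - p) * q) with hT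
  suffices h : ∀ M ≤ N, ∑ j ∈ Finset.range M,
      (thickening (3 * (ρ / 2 ^ j)) D).indicator (wolffDensity n p ν 6 (ρ / 2 ^ j)) y ≤ 5 * T from
    h N le_rfl
  intro M
  induction M with
  | zero => simp
  | succ M ih =>
    intro hM
    by_cases hy : y ∈ thickening (3 * (ρ / 2 ^ M)) D
    · obtain ⟨x, hxD, hx⟩ := mem_thickening_iff.1 hy
      have key : ∀ j, j < M + 1 →
          (thickening (3 * (ρ / 2 ^ j)) D).indicator (wolffDensity n p ν 6 (ρ / 2 ^ j)) y ≤
            T * (if j < 4 then 1 else wolffDensity n p ν 1 (ρ / 2 ^ (j - 4)) x) := by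
        intro j hj
        refine (indicator_le_self _ _ _).trans ?_
        have hrj : 0 < ρ / 2 ^ j := by positivity
        have hR0 : ENNReal.ofReal (ρ / 2 ^ j) ≠ 0 := by simpa using hrj
        have hscale : ENNReal.ofReal (16 * (ρ / 2 ^ j)) ^ ((n : ℝ) - p) =
            16 ^ ((n : ℝ) - p) * ENNReal.ofReal (ρ / 2 ^ j) ^ ((n : ℝ) - p) := by
          rw [ENNReal.ofReal_mul (by norm_num), ENNReal.mul_rpow_of_nonneg _ _ hs0.le]
          norm_num
        have hTq : T = (16 ^ ((n : ℝ) - p)) ^ q := by rw [hT, ENNReal.rpow_mul]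
        have hRp0 : ENNReal.ofReal (ρ / 2 ^ j) ^ ((n : ℝ) - p) ≠ 0 :=
          (ENNReal.rpow_pos (pos_iff_ne_zero.2 hR0) ENNReal.ofReal_ne_top).ne'
        have hRpt : ENNReal.ofReal (ρ / 2 ^ j) ^ ((n : ℝ) - p) ≠ ⊤ :=
          ENNReal.rpow_ne_top_of_nonneg hs0.le ENNReal.ofReal_ne_top
        split_ifs with h4
        · rw [mul_one, hTq, wolffDensity]
          refine ENNReal.rpow_le_rpow ?_ hq0.le
          rw [ENNReal.div_le_iff hRp0 hRpt, ← hscale]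
          refine (measure_mono (subset_univ _)).trans (hν.trans ?_)
          refine ENNReal.rpow_le_rpow (ENNReal.ofReal_le_ofReal ?_) hs0.le
          have h2 : (2 : ℝ) ^ j ≤ 2 ^ 4 := pow_le_pow_right₀ (by norm_num) h4.le
          rw [← mul_div_assoc, le_div_iff₀ (by positivity)]
          nlinarith
        · have hj4 : ρ / 2 ^ (j - 4) = 16 * (ρ / 2 ^ j) := by
            have : (2 : ℝ) ^ j = 2 ^ (j - 4) * 2 ^ 4 := by
              rw [← pow_add, Nat.sub_add_cancel (by omega)]
            rw [this]
            field_simp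
            norm_num
          rw [hTq, wolffDensity, wolffDensity, ← ENNReal.mul_rpow_of_nonneg _ _ hq0.le, hj4, hscale]
          refine ENNReal.rpow_le_rpow ?_ hq0.le
          have h16 : (16 : ℝ≥0∞) ^ ((n : ℝ) - p) ≠ 0 :=
            (ENNReal.rpow_pos (by norm_num) (by norm_num)).ne'
          have h16t : (16 : ℝ≥0∞) ^ ((n : ℝ) - p) ≠ ⊤ :=
            ENNReal.rpow_ne_top_of_nonneg hs0.le (by norm_num)
          have hcancel : ∀ a b : ℝ≥0∞, 16 ^ ((n : ℝ) - p) * (a / (16 ^ ((n : ℝ) - p) * b)) = a / b :=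
            fun a b => by rw [← mul_div_assoc, ENNReal.mul_div_mul_left _ _ h16 h16t]
          rw [hcancel]
          refine ENNReal.div_le_div_right (measure_mono (ball_subset_ball' ?_)) _
          have : ρ / 2 ^ M ≤ ρ / 2 ^ j := by
            have : (2 : ℝ) ^ j ≤ 2 ^ M := pow_le_pow_right₀ (by norm_num) (by omega)
            gcongr
          linarith
      calc _ ≤ ∑ j ∈ Finset.range (M + 1),
            T * (if j < 4 then 1 else wolffDensity n p ν 1 (ρ / 2 ^ (j - 4)) x) :=
            Finset.sum_le_sum fun j hj => key j (Finset.mem_range.1 hj)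
        _ ≤ ∑ j ∈ Finset.range (N + 4),
            T * (if j < 4 then 1 else wolffDensity n p ν 1 (ρ / 2 ^ (j - 4)) x) :=
            Finset.sum_le_sum_of_subset (Finset.range_mono (by omega))
        _ = T * ∑ k ∈ Finset.range N, wolffDensity n p ν 1 (ρ / 2 ^ k) x + T * 4 := by
            rw [← Finset.mul_sum, Finset.sum_range_succ', Finset.sum_range_succ',
              Finset.sum_range_succ', Finset.sum_range_succ', ← mul_add]
            simp only [add_assoc, Nat.reduceAdd]
            norm_num
        _ ≤ T * 1 + T * 4 := by gcongr; exact hD x hxD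
        _ = 5 * T := by ring
    · rw [Finset.sum_range_succ, indicator_of_notMem hy, add_zero]
      exact ih (by omega)

lemma exists_setLIntegral_sum_wolffDensity_rpow_le {n : ℕ} {p : ℝ} (hp : 2 ≤ p) (hpn : p < n) :
    ∃ C : ℝ≥0∞, C ≠ ⊤ ∧ ∀ (ρ : ℝ), 0 < ρ → ∀ (ν : Measure (Euc n)) [IsFiniteMeasure ν],
      ν univ ≤ ENNReal.ofReal ρ ^ ((n : ℝ) - p) → ∀ (N : ℕ) (D : Set (Euc n)), MeasurableSet D →
      (∀ x ∈ D, ∑ k ∈ Finset.range N, wolffDensity n p ν 1 (ρ / 2 ^ k) x ≤ 1) →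
      ∫⁻ x in D, (∑ k ∈ Finset.range N,
        (ENNReal.ofReal (ρ / 2 ^ k))⁻¹ * wolffDensity n p ν 3 (ρ / 2 ^ k) x) ^ p ≤ C * ν univ := by
  have hn : 0 < n := by
    have : (0 : ℝ) < n := by linarith
    exact_mod_cast this
  set q := 1 / (p - 1) with hq
  have hp1 : 0 < p - 1 := by linarith
  have hq0 : 0 < q := by positivity
  set θ : ℝ≥0∞ := 2⁻¹ ^ (q / 2) with hθ
  have hθ1 : θ < 1 := ENNReal.rpow_lt_one (by simp) (by positivity)
  have hθ0 : θ ≠ 0 := (ENNReal.rpow_pos (by simp) (by simp)).ne'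
  have hθt : θ ≠ ⊤ := hθ1.ne_top
  have hB : 1 < θ⁻¹ := ENNReal.one_lt_inv.2 hθ1
  obtain ⟨K, hK, hsum⟩ := ENNReal.exists_sum_rpow_le (by linarith : 1 < p) hB
  set W := ENNReal.ofReal 3 ^ (n : ℝ) * volume (ball (0 : Euc n) 1) with hW
  have hWt : W ≠ ⊤ := ENNReal.mul_ne_top (ENNReal.rpow_ne_top_of_nonneg (by positivity)
    ENNReal.ofReal_ne_top) measure_ball_lt_top.ne
  set T : ℝ≥0∞ := 5 * 16 ^ (((n : ℝ) - p) * q) with hT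
  have hTt : T ≠ ⊤ := ENNReal.mul_ne_top (by simp) (ENNReal.rpow_ne_top_of_nonneg
    (mul_nonneg (by linarith) hq0.le) (by simp))
  refine ⟨K * (W * ((1 - θ)⁻¹ * T)), ?_, ?_⟩
  · refine ENNReal.mul_ne_top hK (ENNReal.mul_ne_top hWt (ENNReal.mul_ne_top ?_ hTt))
    exact ENNReal.inv_ne_top.2 (tsub_pos_of_lt hθ1).ne'
  intro ρ hρ ν _ hν N D hD hDs
  set h : ℕ → Euc n → ℝ≥0∞ :=
    fun k x => (ENNReal.ofReal (ρ / 2 ^ k))⁻¹ * wolffDensity n p ν 3 (ρ / 2 ^ k) x with hh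
  have hhm : ∀ k, Measurable (h k) := fun k => (measurable_wolffDensity ν 3 _).const_mul _
  set b : ℕ → Euc n → ℝ≥0∞ := fun j =>
    (thickening (3 * (ρ / 2 ^ j)) D).indicator (wolffDensity n p ν 6 (ρ / 2 ^ j)) with hb
  have hbm : ∀ j, Measurable (b j) := fun j =>
    (measurable_wolffDensity ν 6 _).indicator isOpen_thickening.measurableSet
  have hpair : ∀ k j, j ≤ k → θ⁻¹ ^ (k - j) * ∫⁻ x in D, h k x * h j x ^ (p - 1) ≤
      W * (θ ^ (k - j) * ∫⁻ y, b j y ∂ν) := by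
    intro k j hjk
    have hle : ρ / 2 ^ k ≤ ρ / 2 ^ j := by
      have : (2 : ℝ) ^ j ≤ 2 ^ k := pow_le_pow_right₀ (by norm_num) hjk
      gcongr
    have hratio : (ENNReal.ofReal (ρ / 2 ^ k) / ENNReal.ofReal (ρ / 2 ^ j)) ^ q =
        (θ ^ (k - j)) * θ ^ (k - j) := by
      rw [← ENNReal.ofReal_div_of_pos (by positivity)]
      have h1 : ρ / 2 ^ k / (ρ / 2 ^ j) = (2⁻¹ : ℝ) ^ (k - j) := by
        have : (2 : ℝ) ^ k = 2 ^ (k - j) * 2 ^ j := by rw [← pow_add, Nat.sub_add_cancel hjk]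
        rw [this, inv_pow]
        field_simp
      rw [h1, ENNReal.ofReal_pow (by norm_num), ENNReal.ofReal_inv_of_pos (by norm_num), ← mul_pow,
        hθ, ← ENNReal.rpow_add_of_nonneg _ _ (by positivity) (by positivity), add_halves,
        ← ENNReal.rpow_natCast, ← ENNReal.rpow_natCast, ← ENNReal.rpow_mul, ← ENNReal.rpow_mul,
        mul_comm q]
      norm_num
    calc θ⁻¹ ^ (k - j) * ∫⁻ x in D, h k x * h j x ^ (p - 1)
        ≤ θ⁻¹ ^ (k - j) * (W * (θ ^ (k - j) * θ ^ (k - j)) * ∫⁻ y, b j y ∂ν) := by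
          rw [← hratio]
          exact mul_le_mul_right (setLIntegral_wolffDensity_mul_rpow_le hn hp ν (by positivity)
            hle D hD) _
      _ = (θ⁻¹ * θ) ^ (k - j) * (W * (θ ^ (k - j) * ∫⁻ y, b j y ∂ν)) := by
          rw [mul_pow]; ring
      _ = _ := by rw [ENNReal.inv_mul_cancel hθ0 hθt, one_pow, one_mul]
  calc ∫⁻ x in D, (∑ k ∈ Finset.range N, h k x) ^ p
      ≤ ∫⁻ x in D, K * ∑ k ∈ Finset.range N, ∑ j ∈ Finset.range (k + 1),
          θ⁻¹ ^ (k - j) * (h k x * h j x ^ (p - 1)) :=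
        lintegral_mono fun x => hsum (fun k => h k x) N
    _ = K * ∑ k ∈ Finset.range N, ∑ j ∈ Finset.range (k + 1),
          θ⁻¹ ^ (k - j) * ∫⁻ x in D, h k x * h j x ^ (p - 1) := by
        have hm : ∀ k j, Measurable fun x => h k x * h j x ^ (p - 1) := fun k j =>
          (hhm k).mul ((hhm j).pow_const _)
        rw [lintegral_const_mul' _ _ hK, lintegral_finsetSum _ fun k _ =>
          Finset.measurable_sum _ fun j _ => (hm k j).const_mul _]
        congr 1
        refine Finset.sum_congr rfl fun k _ => ?_
        rw [lintegral_finsetSum _ fun j _ => (hm k j).const_mul _]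
        exact Finset.sum_congr rfl fun j _ => lintegral_const_mul _ (hm k j)
    _ ≤ K * ∑ k ∈ Finset.range N, ∑ j ∈ Finset.range (k + 1),
          W * (θ ^ (k - j) * ∫⁻ y, b j y ∂ν) := by
        refine mul_le_mul_right (Finset.sum_le_sum fun k _ => Finset.sum_le_sum fun j hj => ?_) _
        exact hpair k j (Nat.lt_succ_iff.1 (Finset.mem_range.1 hj))
    _ = K * ∑ j ∈ Finset.range N, ∑ k ∈ Finset.Ico j N, W * (θ ^ (k - j) * ∫⁻ y, b j y ∂ν) := by
        congr 1
        refine Finset.sum_comm' fun k j => ?_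
        simp only [Finset.mem_range, Finset.mem_Ico]
        omega
    _ ≤ K * ∑ j ∈ Finset.range N, W * ((1 - θ)⁻¹ * ∫⁻ y, b j y ∂ν) := by
        refine mul_le_mul_right (Finset.sum_le_sum fun j _ => ?_) _
        rw [← Finset.mul_sum, ← Finset.sum_mul]
        refine mul_le_mul_right (mul_le_mul_left ?_ _) _
        rw [Finset.sum_Ico_eq_sum_range, ← ENNReal.tsum_geometric]
        simp only [Nat.add_sub_cancel_left]
        exact ENNReal.sum_le_tsum _
    _ = K * (W * ((1 - θ)⁻¹ * ∫⁻ y, ∑ j ∈ Finset.range N, b j y ∂ν)) := by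
        rw [lintegral_finsetSum _ fun j _ => hbm j, ← Finset.mul_sum, ← Finset.mul_sum]
    _ ≤ K * (W * ((1 - θ)⁻¹ * ∫⁻ _, T ∂ν)) := by
        refine mul_le_mul_right (mul_le_mul_right (mul_le_mul_right (lintegral_mono fun y => ?_) _) _) _
        exact sum_indicator_wolffDensity_le (by linarith) hpn ν hρ hν N D hDs y
    _ = K * (W * ((1 - θ)⁻¹ * T)) * ν univ := by
        rw [lintegral_const]
        ring

lemma exists_norm_deriv_smoothTransition_le :
    ∃ M : ℝ, 0 ≤ M ∧ (∀ t, ‖deriv Real.smoothTransition t‖ ≤ M) ∧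
      ∀ t, 1 < t → deriv Real.smoothTransition t = 0 := by
  have h1 : ∀ t, 1 < t → deriv Real.smoothTransition t = 0 := fun t ht => by
    have : Real.smoothTransition =ᶠ[𝓝 t] fun _ => (1 : ℝ) := by
      filter_upwards [lt_mem_nhds ht] with s hs using Real.smoothTransition.one_of_one_le hs.le
    rw [this.deriv_eq, deriv_const]
  have h0 : ∀ t, t < 0 → deriv Real.smoothTransition t = 0 := fun t ht => by
    have : Real.smoothTransition =ᶠ[𝓝 t] fun _ => (0 : ℝ) := by
      filter_upwards [gt_mem_nhds ht] with s hs using Real.smoothTransition.zero_of_nonpos hs.le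
    rw [this.deriv_eq, deriv_const]
  have hc : Continuous (deriv Real.smoothTransition) :=
    (Real.smoothTransition.contDiff (n := 1)).continuous_deriv le_rfl
  obtain ⟨M, hM⟩ := (isCompact_Icc (a := (0 : ℝ)) (b := 1)).exists_bound_of_continuousOn
    hc.continuousOn
  have hM0 : 0 ≤ M := (norm_nonneg _).trans (hM 0 (by simp))
  refine ⟨M, hM0, fun t => ?_, h1⟩
  rcases lt_or_ge t 0 with ht | ht
  · simpa [h0 t ht] using hM0
  rcases lt_or_ge 1 t with ht' | ht'
  · simpa [h1 t ht'] using hM0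
  exact hM t ⟨ht, ht'⟩

lemma wolffDensity_ne_top {n : ℕ} {p : ℝ} (hp : 1 < p) (ν : Measure (Euc n)) [IsFiniteMeasure ν]
    (c : ℝ) {r : ℝ} (hr : 0 < r) (x : Euc n) : wolffDensity n p ν c r x ≠ ⊤ := by
  refine ENNReal.rpow_ne_top_of_nonneg (by have := sub_pos.2 hp; positivity)
    (ENNReal.div_ne_top (measure_ne_top _ _) ?_)
  exact (ENNReal.rpow_pos (by simpa using hr) ENNReal.ofReal_ne_top).ne'

lemma wolffDensity_mono {n : ℕ} {p : ℝ} (hp : 1 < p) (ν : Measure (Euc n)) {c c' r : ℝ}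
    {x y : Euc n} (h : ball x (c * r) ⊆ ball y (c' * r)) :
    wolffDensity n p ν c r x ≤ wolffDensity n p ν c' r y :=
  ENNReal.rpow_le_rpow (ENNReal.div_le_div_right (measure_mono h) _)
    (by have := sub_pos.2 hp; positivity)

lemma exists_contDiff_wolffDensity_le {n : ℕ} (hn : 0 < n) {p : ℝ} (hp : 1 < p) :
    ∃ L : ℝ, 0 < L ∧ ∀ (ν : Measure (Euc n)) [IsFiniteMeasure ν] (r : ℝ), 0 < r →
      ∃ A : Euc n → ℝ, ContDiff ℝ (⊤ : ℕ∞) A ∧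
        (∀ x, 0 ≤ A x) ∧
        (∀ x, wolffDensity n p ν 1 r x ≤ ENNReal.ofReal (A x)) ∧
        (∀ x, ν (ball x (3 * r)) = 0 → A x = 0) ∧
        (∀ x, ‖fderiv ℝ A x‖ₑ ≤
          ENNReal.ofReal L * ((ENNReal.ofReal r)⁻¹ * wolffDensity n p ν 3 r x)) := by
  obtain ⟨L, hL, hmoll⟩ := exists_mollification hn
  refine ⟨L, hL, fun ν _ r hr => ?_⟩
  have hfin : ∀ (c : ℝ) x, wolffDensity n p ν c r x ≠ ⊤ := fun c x =>
    wolffDensity_ne_top hp ν c hr x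
  set m := (ν univ / ENNReal.ofReal r ^ ((n : ℝ) - p)) ^ (1 / (p - 1)) with hm
  have hmt : m ≠ ⊤ := by
    refine ENNReal.rpow_ne_top_of_nonneg (by have := sub_pos.2 hp; positivity)
      (ENNReal.div_ne_top (measure_ne_top _ _) ?_)
    exact (ENNReal.rpow_pos (by simpa using hr) ENNReal.ofReal_ne_top).ne'
  have hsub : ∀ {x z : Euc n}, z ∈ ball x r → ∀ {c c' : ℝ}, c' = c + 1 →
      ball z (c * r) ⊆ ball x (c' * r) := fun {x z} hz {c c'} h => by
    subst h
    refine ball_subset_ball' ?_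
    have := mem_ball.1 hz
    linarith
  obtain ⟨A, hA, hge, hzero, hder⟩ := hmoll r hr (fun x => (wolffDensity n p ν 2 r x).toReal)
    (measurable_wolffDensity ν 2 r).ennreal_toReal
    ⟨m.toReal, fun x => by
      rw [abs_of_nonneg ENNReal.toReal_nonneg]
      exact ENNReal.toReal_mono hmt (ENNReal.rpow_le_rpow (ENNReal.div_le_div_right
        (measure_mono (subset_univ _)) _) (by have := sub_pos.2 hp; positivity))⟩
    fun x => ENNReal.toReal_nonneg
  refine ⟨A, hA, fun x => hge x 0 fun z _ => ENNReal.toReal_nonneg, fun x => ?_, fun x hx => ?_,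
    fun x => ?_⟩
  · rw [← ENNReal.ofReal_toReal (hfin 1 x)]
    refine ENNReal.ofReal_le_ofReal (hge x _ fun z hz => ENNReal.toReal_mono (hfin 2 z) ?_)
    rw [mem_ball_comm] at hz
    exact wolffDensity_mono hp ν (hsub hz (by norm_num))
  · refine hzero x fun z hz => ?_
    have h0 : wolffDensity n p ν 2 r z = 0 := by
      have : ν (ball z (2 * r)) = 0 := measure_mono_null (hsub hz (by norm_num)) hx
      rw [wolffDensity, this, ENNReal.zero_div, ENNReal.zero_rpow_of_pos]
      have := sub_pos.2 hp
      positivity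
    simp [h0]
  · have h := hder x (wolffDensity n p ν 3 r x).toReal fun z hz =>
      ENNReal.toReal_mono (hfin 3 x) (wolffDensity_mono hp ν (hsub hz (by norm_num)))
    rw [← ofReal_norm]
    refine (ENNReal.ofReal_le_ofReal h).trans (le_of_eq ?_)
    rw [ENNReal.ofReal_mul (by positivity), ENNReal.ofReal_toReal (hfin 3 x), div_eq_mul_inv,
      ENNReal.ofReal_mul hL.le, ENNReal.ofReal_inv_of_pos hr, mul_assoc]

lemma exists_varCap_tsum_wolffDensity_le {n : ℕ} {p : ℝ} (hp : 2 ≤ p) (hpn : p < n) :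
    ∃ C : ℝ≥0∞, C ≠ ⊤ ∧ ∀ (ρ : ℝ), 0 < ρ → ∀ (ν : Measure (Euc n)) [IsFiniteMeasure ν],
      ν univ ≤ ENNReal.ofReal ρ ^ ((n : ℝ) - p) → ∀ Z : Set (Euc n), IsCompact Z →
      (∀ x ∉ Z, ν (ball x (3 * ρ)) = 0) →
      varCap n p {x | 1 < ∑' k, wolffDensity n p ν 1 (ρ / 2 ^ k) x} Z ≤ C * ν univ := by
  have hn : 0 < n := by
    have : (0 : ℝ) < n := by linarith
    exact_mod_cast this
  have hp0 : 0 ≤ p := by linarith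
  obtain ⟨C, hC, henergy⟩ := exists_setLIntegral_sum_wolffDensity_rpow_le hp hpn
  obtain ⟨L, hL, hmoll⟩ := exists_contDiff_wolffDensity_le hn (by linarith : 1 < p)
  obtain ⟨M, hM0, hM, hM1⟩ := exists_norm_deriv_smoothTransition_le
  have hKt : (ENNReal.ofReal M * ENNReal.ofReal L) ^ p ≠ ⊤ := ENNReal.rpow_ne_top_of_nonneg hp0
    (ENNReal.mul_ne_top ENNReal.ofReal_ne_top ENNReal.ofReal_ne_top)
  refine ⟨(ENNReal.ofReal M * ENNReal.ofReal L) ^ p * C, ENNReal.mul_ne_top hKt hC, ?_⟩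
  intro ρ hρ ν _ hν Z hZ hZν
  have hr : ∀ k : ℕ, 0 < ρ / 2 ^ k := fun k => by positivity
  choose A hA hA0 hAge hAzero hAder using fun k => hmoll ν (ρ / 2 ^ k) (hr k)
  set S : ℕ → Euc n → ℝ := fun N x => ∑ k ∈ Finset.range N, A k x with hS
  have hSd : ∀ N, ContDiff ℝ (⊤ : ℕ∞) (S N) := fun N => ContDiff.sum fun k _ => hA k
  have hSmono : ∀ x, Monotone fun N => S N x := fun x N N' h =>
    Finset.sum_le_sum_of_subset_of_nonneg (Finset.range_mono h) fun k _ _ => hA0 k x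
  have hSge : ∀ N x, ∑ k ∈ Finset.range N, wolffDensity n p ν 1 (ρ / 2 ^ k) x ≤
      ENNReal.ofReal (S N x) := fun N x => by
    rw [hS, ENNReal.ofReal_sum_of_nonneg fun k _ => hA0 k x]
    exact Finset.sum_le_sum fun k _ => hAge k x
  have hSZ : ∀ N x, x ∉ Z → S N x = 0 := fun N x hx => by
    refine Finset.sum_eq_zero fun k _ => hAzero k x (measure_mono_null (ball_subset_ball ?_) (hZν x hx))
    have : ρ / 2 ^ k ≤ ρ := div_le_self hρ.le (one_le_pow₀ (by norm_num))
    linarith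
  have hopen : ∀ N, IsOpen {x | 1 < S N x} := fun N =>
    isOpen_lt continuous_const (hSd N).continuous
  have hsub : {x | 1 < ∑' k, wolffDensity n p ν 1 (ρ / 2 ^ k) x} ⊆ ⋃ N, {x | 1 < S N x} := by
    intro x hx
    rw [mem_ofPred_eq, ENNReal.tsum_eq_iSup_nat, lt_iSup_iff] at hx
    obtain ⟨N, hN⟩ := hx
    refine mem_iUnion.2 ⟨N, ?_⟩
    have := hN.trans_le (hSge N x)
    rwa [ENNReal.one_lt_ofReal] at this
  have hsubZ : ⋃ N, {x | 1 < S N x} ⊆ Z := by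
    refine iUnion_subset fun N x hx => ?_
    by_contra hxZ
    rw [mem_ofPred_eq, hSZ N x hxZ] at hx
    linarith
  refine (iInf₂_le (⋃ N, {x | 1 < S N x}) ⟨isOpen_iUnion hopen, hsub, hsubZ⟩).trans ?_
  refine iSup₂_le fun K ⟨hK, hKG⟩ => ?_
  obtain ⟨N, hN⟩ := hK.elim_directed_cover _ hopen hKG
    (directed_of_isDirected_le fun N N' h x hx => lt_of_lt_of_le hx (hSmono x h))
  have hud : ContDiff ℝ (⊤ : ℕ∞) fun x => Real.smoothTransition (S N x) :=
    Real.smoothTransition.contDiff.comp (hSd N)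
  have hts : tsupport (fun x => Real.smoothTransition (S N x)) ⊆ Z := by
    refine closure_minimal (fun x hx => ?_) hZ.isClosed
    by_contra hxZ
    exact hx (by simp [hSZ N x hxZ])
  have hcap : varCapCompact n p K Z ≤
      ∫⁻ x in Z, ENNReal.ofReal (‖fderiv ℝ (fun x => Real.smoothTransition (S N x)) x‖ ^ p) := by
    refine sInf_le (Set.mem_ofPred_eq ▸ ?_)
    exact ⟨fun x => Real.smoothTransition (S N x), hud,
      hZ.of_isClosed_subset (isClosed_tsupport _) hts, hts, fun x hx =>
      (Real.smoothTransition.one_of_one_le (hN hx).le).ge, rfl⟩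
  refine hcap.trans ?_
  set D := {x | S N x ≤ 1} with hD
  have hDm : MeasurableSet D := (isClosed_le (hSd N).continuous continuous_const).measurableSet
  set h : Euc n → ℝ≥0∞ := fun x => ∑ k ∈ Finset.range N,
    (ENNReal.ofReal (ρ / 2 ^ k))⁻¹ * wolffDensity n p ν 3 (ρ / 2 ^ k) x with hh
  have hpt : ∀ x, ENNReal.ofReal (‖fderiv ℝ (fun x => Real.smoothTransition (S N x)) x‖ ^ p) ≤
      D.indicator (fun x => (ENNReal.ofReal M * ENNReal.ofReal L) ^ p * h x ^ p) x := by
    intro x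
    have hfd : fderiv ℝ (fun x => Real.smoothTransition (S N x)) x =
        deriv Real.smoothTransition (S N x) • fderiv ℝ (S N) x :=
      (((Real.smoothTransition.contDiff (n := 1)).differentiable one_ne_zero _).hasDerivAt.comp_hasFDerivAt
        x (((hSd N).differentiable (by simp)) x).hasFDerivAt).fderiv
    rw [hfd, ← ENNReal.ofReal_rpow_of_nonneg (norm_nonneg _) hp0]
    by_cases hx : x ∈ D
    · rw [ofReal_norm, indicator_of_mem hx, ← ENNReal.mul_rpow_of_nonneg _ _ hp0, enorm_smul, mul_assoc]
      refine ENNReal.rpow_le_rpow (mul_le_mul' ?_ ?_) hp0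
      · rw [← ofReal_norm]
        exact ENNReal.ofReal_le_ofReal (hM _)
      · have : fderiv ℝ (S N) x = ∑ k ∈ Finset.range N, fderiv ℝ (A k) x :=
          fderiv_fun_sum fun k _ => (hA k).differentiable (by simp) x
        rw [this, hh, Finset.mul_sum]
        have hle : ‖∑ k ∈ Finset.range N, fderiv ℝ (A k) x‖ₑ ≤
            ∑ k ∈ Finset.range N, ‖fderiv ℝ (A k) x‖ₑ := by
          simp_rw [← ofReal_norm]
          rw [← ENNReal.ofReal_sum_of_nonneg fun _ _ => norm_nonneg _]
          exact ENNReal.ofReal_le_ofReal (norm_sum_le _ _)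
        exact hle.trans (Finset.sum_le_sum fun k _ => hAder k x)
    · rw [hM1 _ (not_le.1 hx), zero_smul, norm_zero, ENNReal.ofReal_zero,
        ENNReal.zero_rpow_of_pos (by linarith)]
      exact zero_le
  calc ∫⁻ x in Z, ENNReal.ofReal (‖fderiv ℝ (fun x => Real.smoothTransition (S N x)) x‖ ^ p)
      ≤ ∫⁻ x, D.indicator (fun x => (ENNReal.ofReal M * ENNReal.ofReal L) ^ p * h x ^ p) x :=
        (setLIntegral_le_lintegral _ _).trans (lintegral_mono hpt)
    _ = (ENNReal.ofReal M * ENNReal.ofReal L) ^ p * ∫⁻ x in D, h x ^ p := by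
        rw [lintegral_indicator hDm, lintegral_const_mul' _ _ hKt]
    _ ≤ (ENNReal.ofReal M * ENNReal.ofReal L) ^ p * (C * ν univ) := by
        refine mul_le_mul_right (henergy ρ hρ ν hν N D hDm fun x hx => ?_) _
        exact (hSge N x).trans (ENNReal.ofReal_le_one.2 hx)
    _ = _ := (mul_assoc _ _ _).symm

lemma varCap_mono {n : ℕ} {p : ℝ} {E E' Ω : Set (Euc n)} (h : E ⊆ E') :
    varCap n p E Ω ≤ varCap n p E' Ω :=
  le_iInf₂ fun G hG => iInf₂_le G ⟨hG.1, h.trans hG.2.1, hG.2.2⟩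

lemma mem_wAnn_iff {n i : ℕ} {x₀ x : Euc n} :
    x ∈ wAnn n i x₀ ↔ (2⁻¹ : ℝ) ^ i ≤ ‖x - x₀‖ ∧ ‖x - x₀‖ ≤ 2 * (2⁻¹ : ℝ) ^ i := by
  have h1 : (2 : ℝ) ^ (-(i : ℤ)) = (2⁻¹ : ℝ) ^ i := by rw [zpow_neg, zpow_natCast, inv_pow]
  rw [wAnn, mem_ofPred_eq, mem_Icc, zpow_add₀ two_ne_zero, h1, zpow_one, mul_comm (2 : ℝ)]

lemma mem_wAnnO_iff {n i : ℕ} {x₀ x : Euc n} :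
    x ∈ wAnnO n i x₀ ↔ (2⁻¹ : ℝ) ^ i / 2 ≤ ‖x - x₀‖ ∧ ‖x - x₀‖ ≤ 4 * (2⁻¹ : ℝ) ^ i := by
  have h1 : (2 : ℝ) ^ (-(i : ℤ)) = (2⁻¹ : ℝ) ^ i := by rw [zpow_neg, zpow_natCast, inv_pow]
  have h2 : (2 : ℝ) ^ (2 : ℤ) = 4 := by norm_num
  rw [wAnnO, mem_ofPred_eq, mem_Icc, zpow_add₀ two_ne_zero, zpow_sub₀ two_ne_zero, h1, h2, zpow_one,
    mul_comm (4 : ℝ)]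

lemma isCompact_wAnnO {n i : ℕ} {x₀ : Euc n} : IsCompact (wAnnO n i x₀) := by
  refine (isCompact_closedBall x₀ (4 * (2⁻¹ : ℝ) ^ i)).of_isClosed_subset ?_ fun x hx => ?_
  · exact isClosed_Icc.preimage (by fun_prop : Continuous fun x : Euc n => ‖x - x₀‖)
  · rw [mem_closedBall_iff_norm]
    exact (mem_wAnnO_iff.1 hx).2

lemma varCap_wAnn_lt_top {n : ℕ} {p : ℝ} (hp : 0 ≤ p) (i : ℕ) (x₀ : Euc n) :
    varCap n p (wAnn n i x₀) (wAnnO n i x₀) < ⊤ := by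
  set σ : ℝ := (2⁻¹ : ℝ) ^ i with hσ
  have hσ0 : 0 < σ := by positivity
  set u : Euc n → ℝ := fun x =>
    Real.smoothTransition ((‖x - x₀‖ ^ 2 - (σ / 2) ^ 2) / ((3 * σ / 4) ^ 2 - (σ / 2) ^ 2)) *
      Real.smoothTransition (((4 * σ) ^ 2 - ‖x - x₀‖ ^ 2) / ((4 * σ) ^ 2 - (3 * σ) ^ 2)) with hu
  have hd1 : 0 < (3 * σ / 4) ^ 2 - (σ / 2) ^ 2 := by nlinarith
  have hd2 : 0 < (4 * σ) ^ 2 - (3 * σ) ^ 2 := by nlinarith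
  have hns : ContDiff ℝ (⊤ : ℕ∞) fun x : Euc n => ‖x - x₀‖ ^ 2 :=
    (contDiff_id.sub contDiff_const).norm_sq ℝ
  have hud : ContDiff ℝ (⊤ : ℕ∞) u :=
    (Real.smoothTransition.contDiff.comp ((hns.sub contDiff_const).div_const _)).mul
      (Real.smoothTransition.contDiff.comp ((contDiff_const.sub hns).div_const _))
  have hts : tsupport u ⊆ wAnnO n i x₀ := by
    refine closure_minimal (fun x hx => ?_) isCompact_wAnnO.isClosed
    rw [mem_wAnnO_iff, ← hσ]
    by_contra hcon
    apply hx
    rcases not_and_or.1 hcon with h | h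
    · have : (‖x - x₀‖ ^ 2 - (σ / 2) ^ 2) / ((3 * σ / 4) ^ 2 - (σ / 2) ^ 2) ≤ 0 :=
        div_nonpos_of_nonpos_of_nonneg (by nlinarith [norm_nonneg (x - x₀)]) hd1.le
      simp [hu, Real.smoothTransition.zero_of_nonpos this]
    · have : ((4 * σ) ^ 2 - ‖x - x₀‖ ^ 2) / ((4 * σ) ^ 2 - (3 * σ) ^ 2) ≤ 0 :=
        div_nonpos_of_nonpos_of_nonneg (by nlinarith [norm_nonneg (x - x₀)]) hd2.le
      simp [hu, Real.smoothTransition.zero_of_nonpos this]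
  set G : Set (Euc n) := {x | ‖x - x₀‖ ∈ Ioo (3 * σ / 4) (3 * σ)} with hG
  have hGo : IsOpen G := isOpen_Ioo.preimage (by fun_prop : Continuous fun x : Euc n => ‖x - x₀‖)
  have hGE : wAnn n i x₀ ⊆ G := fun x hx => by
    obtain ⟨h1, h2⟩ := mem_wAnn_iff.1 hx
    exact ⟨by linarith, by linarith⟩
  have hGO : G ⊆ wAnnO n i x₀ := fun x hx => by
    rw [mem_wAnnO_iff]
    exact ⟨by linarith [hx.1], by linarith [hx.2]⟩
  have hu1 : ∀ x ∈ G, 1 ≤ u x := fun x hx => by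
    have h1 : 1 ≤ (‖x - x₀‖ ^ 2 - (σ / 2) ^ 2) / ((3 * σ / 4) ^ 2 - (σ / 2) ^ 2) := by
      rw [one_le_div hd1]
      nlinarith [hx.1]
    have h2 : 1 ≤ ((4 * σ) ^ 2 - ‖x - x₀‖ ^ 2) / ((4 * σ) ^ 2 - (3 * σ) ^ 2) := by
      rw [one_le_div hd2]
      nlinarith [hx.2, norm_nonneg (x - x₀)]
    simp [hu, Real.smoothTransition.one_of_one_le h1, Real.smoothTransition.one_of_one_le h2]
  have hfin : ∫⁻ x in wAnnO n i x₀, ENNReal.ofReal (‖fderiv ℝ u x‖ ^ p) < ⊤ := by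
    have hc : Continuous fun x => ‖fderiv ℝ u x‖ ^ p :=
      (hud.continuous_fderiv (by simp)).norm.rpow_const fun _ => Or.inr hp
    exact (hc.continuousOn.integrableOn_compact isCompact_wAnnO).lintegral_lt_top
  refine lt_of_le_of_lt (iInf₂_le G ⟨hGo, hGE, hGO⟩) (lt_of_le_of_lt ?_ hfin)
  refine iSup₂_le fun K hK => sInf_le (Set.mem_ofPred_eq ▸ ?_)
  exact ⟨u, hud, isCompact_wAnnO.of_isClosed_subset (isClosed_tsupport _) hts, hts,
    fun x hx => hu1 x (hK.2 hx), rfl⟩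

lemma wolffPotential_eq {n : ℕ} {p : ℝ} (μ : Measure (Euc n)) (x : Euc n) (r : ℝ) :
    wolffPotential n p μ x r =
      ∫⁻ t in Ioo (0 : ℝ) r, wolffDensity n p μ 1 t x * (ENNReal.ofReal t)⁻¹ := by
  refine setLIntegral_congr_fun measurableSet_Ioo fun t ht => ?_
  simp only [wolffDensity, one_mul]
  rw [ENNReal.ofReal_rpow_of_pos ht.1, ENNReal.ofReal_inv_of_pos ht.1]

lemma setLIntegral_wolffDensity_Ioo_le {n : ℕ} {p : ℝ} (hp : 1 < p) (hpn : p < n)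
    (μ : Measure (Euc n)) (x : Euc n) {ρ : ℝ} (hρ : 0 < ρ) :
    ∫⁻ t in Ioo (0 : ℝ) ρ, wolffDensity n p μ 1 t x * (ENNReal.ofReal t)⁻¹ ≤
      2 ^ (((n : ℝ) - p) * (1 / (p - 1))) * ∑' k, wolffDensity n p μ 1 (ρ / 2 ^ k) x := by
  have hp1 : 0 < p - 1 := by linarith
  have hq0 : 0 ≤ 1 / (p - 1) := by positivity
  have hs0 : 0 < (n : ℝ) - p := by linarith
  set I : ℕ → Set ℝ := fun k => Ioc (ρ / 2 ^ (k + 1)) (ρ / 2 ^ k) with hI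
  have hcover : Ioo (0 : ℝ) ρ ⊆ ⋃ k, I k := by
    intro t ht
    obtain ⟨k, hk1, hk2⟩ := exists_nat_pow_near_of_lt_one (x := t / ρ) (y := (2⁻¹ : ℝ))
      (div_pos ht.1 hρ) ((div_le_one hρ).2 ht.2.le) (by norm_num) (by norm_num)
    rw [lt_div_iff₀ hρ] at hk1
    rw [div_le_iff₀ hρ] at hk2
    refine mem_iUnion.2 ⟨k, ?_, ?_⟩
    · rw [div_eq_mul_inv, ← inv_pow]; linarith
    · rw [div_eq_mul_inv, ← inv_pow]; linarith
  refine (lintegral_mono_set hcover).trans ((lintegral_iUnion_le _ _).trans ?_)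
  rw [← ENNReal.tsum_mul_left]
  refine ENNReal.tsum_le_tsum fun k => ?_
  set r := ρ / 2 ^ (k + 1) with hr
  have hr0 : 0 < r := by positivity
  have hrk : ρ / 2 ^ k = 2 * r := by rw [hr, pow_succ]; field_simp
  have hR0 : ENNReal.ofReal r ≠ 0 := by simpa using hr0
  have hRt : ENNReal.ofReal r ≠ ⊤ := ENNReal.ofReal_ne_top
  have hbound : ∀ t ∈ I k, wolffDensity n p μ 1 t x * (ENNReal.ofReal t)⁻¹ ≤
      2 ^ (((n : ℝ) - p) * (1 / (p - 1))) * wolffDensity n p μ 1 (ρ / 2 ^ k) x *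
        (ENNReal.ofReal r)⁻¹ := by
    intro t ht
    have htr : r < t := ht.1
    have ht2 : t ≤ 2 * r := hrk ▸ ht.2
    refine mul_le_mul' ?_ (ENNReal.inv_le_inv.2 (ENNReal.ofReal_le_ofReal htr.le))
    rw [ENNReal.rpow_mul, wolffDensity, wolffDensity, ← ENNReal.mul_rpow_of_nonneg _ _ hq0, hrk]
    refine ENNReal.rpow_le_rpow ?_ hq0
    have h2 : (2 : ℝ≥0∞) ^ ((n : ℝ) - p) ≠ 0 := (ENNReal.rpow_pos (by norm_num) (by norm_num)).ne'
    have h2t : (2 : ℝ≥0∞) ^ ((n : ℝ) - p) ≠ ⊤ := ENNReal.rpow_ne_top_of_nonneg hs0.le (by norm_num)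
    have hcancel : ∀ a b : ℝ≥0∞, 2 ^ ((n : ℝ) - p) * (a / (2 ^ ((n : ℝ) - p) * b)) = a / b :=
      fun a b => by rw [← mul_div_assoc, ENNReal.mul_div_mul_left _ _ h2 h2t]
    rw [ENNReal.ofReal_mul two_pos.le, ENNReal.mul_rpow_of_nonneg _ _ hs0.le, ENNReal.ofReal_ofNat,
      hcancel]
    exact ENNReal.div_le_div (measure_mono (ball_subset_ball (by linarith)))
      (ENNReal.rpow_le_rpow (ENNReal.ofReal_le_ofReal htr.le) hs0.le)
  refine (setLIntegral_mono' measurableSet_Ioc hbound).trans ?_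
  rw [setLIntegral_const, Real.volume_Ioc, hrk, two_mul, add_sub_cancel_right, mul_assoc,
    ENNReal.inv_mul_cancel hR0 hRt, mul_one]

lemma setLIntegral_wolffDensity_Ici_le {n : ℕ} {p m : ℝ} (hp : 1 < p) (hm : m < (n : ℝ) - p)
    (μ : Measure (Euc n)) (x : Euc n) {ρ K : ℝ} (hρ : 0 < ρ) (hK : 0 ≤ K)
    (hgrowth : ∀ t, ρ ≤ t → μ (ball x t) ≤ ENNReal.ofReal (K * t ^ m)) :
    ∫⁻ t in Ici ρ, wolffDensity n p μ 1 t x * (ENNReal.ofReal t)⁻¹ ≤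
      ENNReal.ofReal (K ^ (1 / (p - 1)) / (((n : ℝ) - p - m) * (1 / (p - 1))) *
        ρ ^ (-(((n : ℝ) - p - m) * (1 / (p - 1))))) := by
  have hp1 : 0 < p - 1 := by linarith
  set q := 1 / (p - 1) with hq
  have hq0 : 0 < q := by positivity
  set β := ((n : ℝ) - p - m) * q with hβ
  have hβ0 : 0 < β := mul_pos (by linarith) hq0
  have hbound : ∀ t ∈ Ici ρ, wolffDensity n p μ 1 t x * (ENNReal.ofReal t)⁻¹ ≤
      ENNReal.ofReal (K ^ q * t ^ (-β - 1)) := by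
    intro t ht
    have ht0 : 0 < t := hρ.trans_le ht
    calc wolffDensity n p μ 1 t x * (ENNReal.ofReal t)⁻¹
        ≤ (ENNReal.ofReal (K * t ^ m) / ENNReal.ofReal t ^ ((n : ℝ) - p)) ^ q *
            (ENNReal.ofReal t)⁻¹ := by
          refine mul_le_mul_left (ENNReal.rpow_le_rpow (ENNReal.div_le_div_right ?_ _) hq0.le) _
          rw [one_mul]
          exact hgrowth t ht
      _ = ENNReal.ofReal ((K * t ^ m / t ^ ((n : ℝ) - p)) ^ q * t⁻¹) := by
          rw [ENNReal.ofReal_mul (q := t⁻¹) (by positivity), ENNReal.ofReal_inv_of_pos ht0,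
            ← ENNReal.ofReal_rpow_of_nonneg (by positivity) hq0.le,
            ENNReal.ofReal_div_of_pos (by positivity), ENNReal.ofReal_rpow_of_pos ht0]
      _ = ENNReal.ofReal (K ^ q * t ^ (-β - 1)) := by
          congr 1
          rw [mul_div_assoc, ← Real.rpow_sub ht0, Real.mul_rpow hK (by positivity),
            ← Real.rpow_mul ht0.le, mul_assoc, ← Real.rpow_neg_one t, ← Real.rpow_add ht0]
          congr 2
          rw [hβ]
          ring
  have hint : IntegrableOn (fun t => K ^ q * t ^ (-β - 1)) (Ioi ρ) :=
    (integrableOn_Ioi_rpow_of_lt (by linarith) hρ).const_mul _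
  calc ∫⁻ t in Ici ρ, wolffDensity n p μ 1 t x * (ENNReal.ofReal t)⁻¹
      ≤ ∫⁻ t in Ici ρ, ENNReal.ofReal (K ^ q * t ^ (-β - 1)) :=
        setLIntegral_mono' measurableSet_Ici hbound
    _ = ∫⁻ t in Ioi ρ, ENNReal.ofReal (K ^ q * t ^ (-β - 1)) := by
        rw [setLIntegral_congr Ioi_ae_eq_Ici]
    _ = ENNReal.ofReal (∫ t in Ioi ρ, K ^ q * t ^ (-β - 1)) := by
        refine (ofReal_integral_eq_lintegral_ofReal hint ?_).symm
        filter_upwards [ae_restrict_mem measurableSet_Ioi] with t ht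
        have : 0 < t := hρ.trans ht
        positivity
    _ = _ := by
        congr 1
        rw [integral_const_mul, integral_Ioi_rpow_of_lt (by linarith) hρ, sub_add_cancel, neg_div_neg_eq]
        ring

lemma wolffPotential_le {n : ℕ} {p m : ℝ} (hp : 1 < p) (hpn : p < n) (hm : m < (n : ℝ) - p)
    (μ : Measure (Euc n)) (x : Euc n) {ρ K : ℝ} (hρ : 0 < ρ) (hK : 0 ≤ K)
    (hgrowth : ∀ t, ρ ≤ t → μ (ball x t) ≤ ENNReal.ofReal (K * t ^ m)) (r : ℝ) :
    wolffPotential n p μ x r ≤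
      2 ^ (((n : ℝ) - p) * (1 / (p - 1))) * ∑' k, wolffDensity n p μ 1 (ρ / 2 ^ k) x +
      ENNReal.ofReal (K ^ (1 / (p - 1)) / (((n : ℝ) - p - m) * (1 / (p - 1))) *
        ρ ^ (-(((n : ℝ) - p - m) * (1 / (p - 1))))) := by
  have hcover : Ioo 0 r ⊆ Ioo 0 ρ ∪ Ici ρ := fun t ht =>
    (lt_or_ge t ρ).imp (fun h => ⟨ht.1, h⟩) id
  rw [wolffPotential_eq]
  refine (lintegral_mono_set hcover).trans ((lintegral_union_le _ _ _).trans (add_le_add ?_ ?_))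
  · exact setLIntegral_wolffDensity_Ioo_le hp hpn μ x hρ
  · exact setLIntegral_wolffDensity_Ici_le hp hm μ x hρ hK hgrowth

lemma exists_measure_ball_le_of_growth {n : ℕ} {m C r : ℝ} (hm : 0 < m) (hr : 0 < r)
    (μ : Measure (Euc n)) [IsFiniteMeasure μ] (x₀ : Euc n)
    (hgrowth : ∀ t ∈ Ioo 0 r, μ (ball x₀ t) ≤ ENNReal.ofReal (C * t ^ m)) :
    ∃ K : ℝ, 0 < K ∧ ∀ t, 0 < t → μ (ball x₀ t) ≤ ENNReal.ofReal (K * t ^ m) := by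
  refine ⟨|C| + μ.real univ / r ^ m + 1, by positivity, fun t ht => ?_⟩
  have htm : 0 < t ^ m := by positivity
  have hD : 0 ≤ μ.real univ / r ^ m := by positivity
  rcases lt_or_ge t r with h | h
  · refine (hgrowth t ⟨ht, h⟩).trans (ENNReal.ofReal_le_ofReal (mul_le_mul_of_nonneg_right ?_ htm.le))
    linarith [le_abs_self C]
  · refine (measure_mono (subset_univ _)).trans ?_
    rw [← ofReal_measureReal]
    refine ENNReal.ofReal_le_ofReal ?_
    have hle : r ^ m ≤ t ^ m := Real.rpow_le_rpow hr.le h hm.le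
    calc μ.real univ = μ.real univ / r ^ m * r ^ m := by field_simp
      _ ≤ μ.real univ / r ^ m * t ^ m := by gcongr
      _ ≤ _ := by
        refine mul_le_mul_of_nonneg_right ?_ htm.le
        linarith [abs_nonneg C]

lemma wolffDensity_smul {n : ℕ} {p : ℝ} (hp : 1 < p) (μ : Measure (Euc n)) (a : ℝ≥0∞) (c r : ℝ)
    (x : Euc n) :
    wolffDensity n p (a • μ) c r x = a ^ (1 / (p - 1)) * wolffDensity n p μ c r x := by
  have : 0 ≤ 1 / (p - 1) := by have := sub_pos.2 hp; positivity
  rw [wolffDensity, wolffDensity, Measure.smul_apply, smul_eq_mul, mul_div_assoc,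
    ENNReal.mul_rpow_of_nonneg _ _ this]

lemma exists_wolffPotential_le_and_varCap_le {n : ℕ} {p m ε K : ℝ} (hp : 2 ≤ p) (hpn : p < n)
    (hm : m < (n : ℝ) - p) (μ : Measure (Euc n)) [IsFiniteMeasure μ] (x₀ : Euc n)
    (hK : 0 < K) (hgrowth : ∀ t, 0 < t → μ (ball x₀ t) ≤ ENNReal.ofReal (K * t ^ m)) (hε : 0 < ε)
    (r : ℝ) :
    ∃ C' : ℝ, 0 < C' ∧ ∃ A : ℝ≥0∞, A ≠ ⊤ ∧ ∃ N : ℕ, ∀ i, N ≤ i →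
      varCap n p ({x | ¬ wolffPotential n p μ x r ≤ ENNReal.ofReal
          (C' * ‖x - x₀‖ ^ (-((n : ℝ) - p - m + ε) / (p - 1)))} ∩ wAnn n i x₀) (wAnnO n i x₀) ≤
        A * ENNReal.ofReal ((2⁻¹ : ℝ) ^ i) ^ ((n : ℝ) - p + ε) := by
  obtain ⟨A₀, hA₀, hcap⟩ := exists_varCap_tsum_wolffDensity_le hp hpn
  have hp1 : 0 < p - 1 := by linarith
  set q := 1 / (p - 1) with hq
  have hq0 : 0 < q := by positivity
  set δ := (n : ℝ) - p - m + ε with hδ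
  have hδ0 : 0 < δ := by linarith
  set β := ((n : ℝ) - p - m) * q with hβ
  have hβ0 : 0 < β := mul_pos (by linarith) hq0
  have hβδ : β ≤ δ * q := mul_le_mul_of_nonneg_right (by linarith) hq0.le
  set K₁ := K * 33 ^ m with hK₁
  have hK₁0 : 0 < K₁ := by positivity
  set c := (K₁ ^ q / β) * 16 ^ β with hc
  have hc0 : 0 < c := by positivity
  set a := (2 : ℝ) ^ (((n : ℝ) - p) * q) with ha
  have ha0 : 0 < a := by positivity
  obtain ⟨N, hN⟩ : ∃ N : ℕ, ∀ i, N ≤ i → K * 3 ^ m * 16 ^ ((n : ℝ) - p) * ((2⁻¹ : ℝ) ^ i) ^ ε ≤ 1 := by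
    have h1 : Tendsto (fun i : ℕ => K * 3 ^ m * 16 ^ ((n : ℝ) - p) * ((2⁻¹ : ℝ) ^ i) ^ ε) atTop
        (𝓝 (K * 3 ^ m * 16 ^ ((n : ℝ) - p) * 0 ^ ε)) :=
      ((tendsto_pow_atTop_nhds_zero_of_lt_one (by norm_num) (by norm_num)).rpow_const
        (Or.inr hε.le)).const_mul _
    rw [Real.zero_rpow hε.ne', mul_zero] at h1
    exact eventually_atTop.1 (h1.eventually_le_const one_pos)
  refine ⟨(a + c) * 2 ^ (δ * q), by positivity, A₀ * ENNReal.ofReal (K * 3 ^ m),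
    ENNReal.mul_ne_top hA₀ ENNReal.ofReal_ne_top, N, fun i hi => ?_⟩
  set σ := (2⁻¹ : ℝ) ^ i with hσ
  have hσ0 : 0 < σ := by positivity
  have hσ1 : σ ≤ 1 := pow_le_one₀ (by norm_num) (by norm_num)
  set ρ := σ / 16 with hρ
  have hρ0 : 0 < ρ := by positivity
  set Y : Set (Euc n) := {y | ‖y - x₀‖ ∈ Icc (σ - ρ) (2 * σ + ρ)} with hY
  set ν : Measure (Euc n) := ENNReal.ofReal (σ ^ δ) • μ.restrict Y with hν
  have hνfin : IsFiniteMeasure ν := Measure.smul_finite _ ENNReal.ofReal_ne_top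
  have hYm : MeasurableSet Y :=
    (isClosed_Icc.preimage (by fun_prop : Continuous fun y : Euc n => ‖y - x₀‖)).measurableSet
  have hνuniv : ν univ ≤ ENNReal.ofReal (K * 3 ^ m) * ENNReal.ofReal σ ^ ((n : ℝ) - p + ε) := by
    have hYb : Y ⊆ ball x₀ (3 * σ) := fun y hy => by
      rw [mem_ball_iff_norm]
      linarith [hy.2]
    rw [hν, Measure.smul_apply, Measure.restrict_apply_univ, smul_eq_mul]
    refine (mul_le_mul_right ((measure_mono hYb).trans (hgrowth _ (by positivity))) _).trans
      (le_of_eq ?_)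
    rw [ENNReal.ofReal_rpow_of_pos hσ0, ← ENNReal.ofReal_mul (by positivity),
      ← ENNReal.ofReal_mul (by positivity), Real.mul_rpow (by norm_num) hσ0.le]
    congr 1
    have : σ ^ ((n : ℝ) - p + ε) = σ ^ δ * σ ^ m := by
      rw [← Real.rpow_add hσ0]
      congr 1
      rw [hδ]
      ring
    rw [this]
    ring
  have hνρ : ν univ ≤ ENNReal.ofReal ρ ^ ((n : ℝ) - p) := by
    refine hνuniv.trans ?_
    rw [ENNReal.ofReal_rpow_of_pos hσ0, ENNReal.ofReal_rpow_of_pos hρ0,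
      ← ENNReal.ofReal_mul (by positivity)]
    refine ENNReal.ofReal_le_ofReal ?_
    rw [hρ, Real.div_rpow hσ0.le (by norm_num), le_div_iff₀ (by positivity), Real.rpow_add hσ0]
    calc K * 3 ^ m * (σ ^ ((n : ℝ) - p) * σ ^ ε) * 16 ^ ((n : ℝ) - p)
        = K * 3 ^ m * 16 ^ ((n : ℝ) - p) * σ ^ ε * σ ^ ((n : ℝ) - p) := by ring
      _ ≤ 1 * σ ^ ((n : ℝ) - p) := mul_le_mul_of_nonneg_right (hN i hi) (by positivity)
      _ = σ ^ ((n : ℝ) - p) := one_mul _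
  have hνZ : ∀ x ∉ wAnnO n i x₀, ν (ball x (3 * ρ)) = 0 := by
    intro x hx
    have hdisj : ball x (3 * ρ) ∩ Y = ∅ := by
      refine eq_empty_of_forall_notMem fun y ⟨hy, hyY⟩ => hx (mem_wAnnO_iff.2 ?_)
      rw [mem_ball_iff_norm] at hy
      have h1 := norm_sub_norm_le (y - x₀) (x - x₀)
      have h2 := norm_sub_norm_le (x - x₀) (y - x₀)
      rw [sub_sub_sub_cancel_right] at h1 h2
      rw [norm_sub_rev x y] at h2
      obtain ⟨h3, h4⟩ := hyY
      exact ⟨by linarith, by linarith⟩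
    rw [hν, Measure.smul_apply, Measure.restrict_apply measurableSet_ball, hdisj, measure_empty,
      smul_zero]
  have hden : ∀ x ∈ wAnn n i x₀, ∑' k, wolffDensity n p ν 1 (ρ / 2 ^ k) x =
      ENNReal.ofReal (σ ^ (δ * q)) * ∑' k, wolffDensity n p μ 1 (ρ / 2 ^ k) x := by
    intro x hx
    obtain ⟨hx1, hx2⟩ := mem_wAnn_iff.1 hx
    rw [← ENNReal.tsum_mul_left]
    refine tsum_congr fun k => ?_
    have hsub : ball x (1 * (ρ / 2 ^ k)) ⊆ Y := fun y hy => by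
      have hk : ρ / 2 ^ k ≤ ρ := div_le_self hρ0.le (one_le_pow₀ (by norm_num))
      rw [mem_ball_iff_norm, one_mul] at hy
      have h1 := norm_sub_norm_le (y - x₀) (x - x₀)
      have h2 := norm_sub_norm_le (x - x₀) (y - x₀)
      rw [sub_sub_sub_cancel_right] at h1 h2
      rw [norm_sub_rev x y] at h2
      exact ⟨by linarith, by linarith⟩
    rw [hν, wolffDensity_smul (by linarith), ENNReal.ofReal_rpow_of_pos (by positivity),
      ← Real.rpow_mul hσ0.le]
    congr 1
    rw [wolffDensity, wolffDensity, Measure.restrict_apply measurableSet_ball,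
      inter_eq_left.2 hsub]
  refine (varCap_mono (E' := {x | 1 < ∑' k, wolffDensity n p ν 1 (ρ / 2 ^ k) x}) ?_).trans
    ((hcap ρ hρ0 ν hνρ (wAnnO n i x₀) isCompact_wAnnO hνZ).trans ?_)
  · rintro x ⟨hxE, hx⟩
    by_contra hle
    refine hxE ?_
    obtain ⟨hx1, hx2⟩ := mem_wAnn_iff.1 hx
    have hx0 : 0 < ‖x - x₀‖ := hσ0.trans_le hx1
    have hsum : ∑' k, wolffDensity n p μ 1 (ρ / 2 ^ k) x ≤ ENNReal.ofReal (σ ^ (-(δ * q))) := by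
      have h1 : ENNReal.ofReal (σ ^ (δ * q)) * ∑' k, wolffDensity n p μ 1 (ρ / 2 ^ k) x ≤ 1 := by
        rw [← hden x hx]
        exact not_lt.1 hle
      have h0 : ENNReal.ofReal (σ ^ (δ * q)) ≠ 0 := by
        rw [Ne, ENNReal.ofReal_eq_zero, not_le]
        positivity
      rw [Real.rpow_neg hσ0.le, ENNReal.ofReal_inv_of_pos (by positivity), ← one_div,
        ENNReal.le_div_iff_mul_le (Or.inl h0) (Or.inl ENNReal.ofReal_ne_top), mul_comm]
      exact h1
    have hgr : ∀ t, ρ ≤ t → μ (ball x t) ≤ ENNReal.ofReal (K₁ * t ^ m) := by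
      intro t ht
      have ht0 : 0 < t := hρ0.trans_le ht
      refine (measure_mono (ball_subset_ball' (ε₂ := 33 * t) ?_)).trans
        ((hgrowth _ (by positivity)).trans (le_of_eq ?_))
      · rw [dist_eq_norm]
        linarith
      · rw [Real.mul_rpow (by norm_num) ht0.le, hK₁, mul_assoc]
    refine (wolffPotential_le (by linarith) hpn hm μ x hρ0 hK₁0.le hgr r).trans ?_
    have h2a : (2 : ℝ≥0∞) ^ (((n : ℝ) - p) * q) = ENNReal.ofReal a := by
      rw [ha, ← ENNReal.ofReal_rpow_of_pos two_pos, ENNReal.ofReal_ofNat]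
    have htail : K₁ ^ q / β * ρ ^ (-β) ≤ c * σ ^ (-(δ * q)) := by
      rw [hρ, Real.div_rpow hσ0.le (by norm_num), Real.rpow_neg (by norm_num : (0 : ℝ) ≤ 16),
        div_inv_eq_mul, hc]
      calc K₁ ^ q / β * (σ ^ (-β) * 16 ^ β) = K₁ ^ q / β * 16 ^ β * σ ^ (-β) := by ring
        _ ≤ _ := mul_le_mul_of_nonneg_left
          (Real.rpow_le_rpow_of_exponent_ge hσ0 hσ1 (by linarith)) hc0.le
    have hσx : σ ^ (-(δ * q)) ≤ 2 ^ (δ * q) * ‖x - x₀‖ ^ (-(δ * q)) := by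
      have h1 : (2 * σ) ^ (-(δ * q)) ≤ ‖x - x₀‖ ^ (-(δ * q)) :=
        Real.rpow_le_rpow_of_nonpos hx0 hx2 (neg_nonpos.2 (by positivity))
      calc σ ^ (-(δ * q)) = 2 ^ (δ * q) * (2 * σ) ^ (-(δ * q)) := by
            rw [Real.mul_rpow two_pos.le hσ0.le, ← mul_assoc, ← Real.rpow_add two_pos,
              add_neg_cancel, Real.rpow_zero, one_mul]
        _ ≤ _ := mul_le_mul_of_nonneg_left h1 (by positivity)
    rw [h2a]
    refine (add_le_add (mul_le_mul_right hsum _) (ENNReal.ofReal_le_ofReal htail)).trans ?_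
    rw [← ENNReal.ofReal_mul ha0.le, ← ENNReal.ofReal_add (by positivity) (by positivity),
      show -δ / (p - 1) = -(δ * q) by rw [hq]; ring]
    refine ENNReal.ofReal_le_ofReal ?_
    rw [← add_mul, mul_assoc (a + c)]
    exact mul_le_mul_of_nonneg_left hσx (by positivity)
  · rw [mul_assoc]
    exact mul_le_mul_right hνuniv _

/-- let `μ` be a nonnegative finite Radon measure on `Ω ⊆ ℝⁿ`,
`x₀ ∈ Ω`, `p ∈ [2, n)`, `m ∈ (0, n-p)`, `B(x₀, 3r₀) ⊆ Ω`, and suppose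
`μ(B(x₀,t)) ≤ C t^m` for all `t ∈ (0, 3r₀)`. Then for every `ε > 0` there are a set
`E ⊆ Ω`, `p`-thin for singular behavior at `x₀`, and a constant `C' > 0` with
`W^μ_{1,p}(x, r₀) ≤ C' |x-x₀|^{-(n-p-m+ε)/(p-1)}` for all `x ∈ Ω \ E`. -/
theorem wolff_potential_upper_bound (n : ℕ) (p m : ℝ) (hp₁ : 2 ≤ p) (hp₂ : p < n)
    (hm₁ : 0 < m) (hm₂ : m < (n : ℝ) - p)
    (Ω : Set (Euc n)) (μ : Measure (Euc n)) [IsFiniteMeasure μ]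
    (x₀ : Euc n) (hx₀ : x₀ ∈ Ω) (r₀ : ℝ) (hr₀ : 0 < r₀)
    (hball : Metric.ball x₀ (3 * r₀) ⊆ Ω) (C : ℝ)
    (hgrowth : ∀ t ∈ Set.Ioo (0 : ℝ) (3 * r₀),
      μ (Metric.ball x₀ t) ≤ ENNReal.ofReal (C * t ^ m)) :
    ∀ ε > (0 : ℝ), ∃ E ⊆ Ω, pThinAt n p E x₀ ∧
      ∃ C' > (0 : ℝ), ∀ x ∈ Ω \ E,
        wolffPotential n p μ x r₀ ≤
          ENNReal.ofReal (C' * ‖x - x₀‖ ^ (-((n : ℝ) - p - m + ε) / (p - 1))) := by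
  intro ε hε
  have hn : 0 < n := by
    have : (0 : ℝ) < n := by linarith
    exact_mod_cast this
  obtain ⟨K, hK, hKgrowth⟩ :=
    exists_measure_ball_le_of_growth hm₁ (by positivity : 0 < 3 * r₀) μ x₀ hgrowth
  obtain ⟨C', hC', A, hA, N, hcap⟩ :=
    exists_wolffPotential_le_and_varCap_le hp₁ hp₂ hm₂ μ x₀ hK hKgrowth hε r₀
  obtain ⟨c, hc0, hct, hsphere⟩ := exists_pos_le_varCap_sphere hn (by linarith : 1 ≤ p)
  set B : Set (Euc n) := {x | ¬ wolffPotential n p μ x r₀ ≤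
    ENNReal.ofReal (C' * ‖x - x₀‖ ^ (-((n : ℝ) - p - m + ε) / (p - 1)))} with hB
  refine ⟨Ω ∩ B, inter_subset_left, ?_, C', hC', fun x hx => ?_⟩
  swap
  · by_contra h
    exact hx.2 ⟨hx.1, h⟩
  rw [pThinAt, if_pos hp₂]
  set f : ℕ → ℝ≥0∞ := fun i =>
    varCap n p (Ω ∩ B ∩ wAnn n (i + 1) x₀) (wAnnO n (i + 1) x₀) /
      varCap n p (Metric.sphere x₀ ((2 : ℝ) ^ (-(i : ℤ) - 1)))
        (Metric.ball x₀ ((2 : ℝ) ^ (-(i : ℤ)))) with hf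
  have hσ0 : ∀ i : ℕ, ENNReal.ofReal ((2⁻¹ : ℝ) ^ (i + 1)) ≠ 0 := fun i => by
    rw [Ne, ENNReal.ofReal_eq_zero, not_le]
    positivity
  have hσp : ∀ i : ℕ, ENNReal.ofReal ((2⁻¹ : ℝ) ^ (i + 1)) ^ ((n : ℝ) - p) ≠ 0 := fun i =>
    (ENNReal.rpow_pos (pos_iff_ne_zero.2 (hσ0 i)) ENNReal.ofReal_ne_top).ne'
  have hσt : ∀ i : ℕ, ENNReal.ofReal ((2⁻¹ : ℝ) ^ (i + 1)) ^ ((n : ℝ) - p) ≠ ⊤ := fun i =>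
    ENNReal.rpow_ne_top_of_nonneg (by linarith) ENNReal.ofReal_ne_top
  have hden : ∀ i : ℕ, c * ENNReal.ofReal ((2⁻¹ : ℝ) ^ (i + 1)) ^ ((n : ℝ) - p) ≤
      varCap n p (Metric.sphere x₀ ((2 : ℝ) ^ (-(i : ℤ) - 1)))
        (Metric.ball x₀ ((2 : ℝ) ^ (-(i : ℤ)))) := by
    intro i
    have h1 : (2 : ℝ) ^ (-(i : ℤ) - 1) = (2⁻¹ : ℝ) ^ (i + 1) := by
      rw [← neg_add', zpow_neg, ← inv_zpow, ← Nat.cast_succ, zpow_natCast]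
    have h2 : (2 : ℝ) ^ (-(i : ℤ)) = 2 * (2⁻¹ : ℝ) ^ (i + 1) := by
      rw [← h1, zpow_sub_one₀ two_ne_zero]
      field_simp
    rw [h1, h2]
    exact hsphere x₀ _ (by positivity)
  have hfin : ∀ i, f i ≠ ⊤ := fun i => by
    refine ENNReal.div_ne_top (lt_of_le_of_lt (varCap_mono inter_subset_right)
      (varCap_wAnn_lt_top (by linarith) (i + 1) x₀)).ne ?_
    exact ((pos_iff_ne_zero.2 (mul_ne_zero hc0 (hσp i))).trans_le (hden i)).ne'
  set θ : ℝ≥0∞ := ENNReal.ofReal 2⁻¹ ^ ε with hθ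
  have hθ1 : θ < 1 := ENNReal.rpow_lt_one (by rw [ENNReal.ofReal_lt_one]; norm_num) hε
  have hterm : ∀ i, N ≤ i → f i ≤ A / c * θ ^ i := by
    intro i hi
    set S := ENNReal.ofReal ((2⁻¹ : ℝ) ^ (i + 1)) with hS
    have hSε : S ^ ε ≤ θ ^ i := by
      rw [hS, ENNReal.ofReal_pow (by norm_num), ← ENNReal.rpow_natCast, ← ENNReal.rpow_mul,
        mul_comm, ENNReal.rpow_mul, ENNReal.rpow_natCast]
      exact pow_le_pow_right_of_le_one' hθ1.le (Nat.le_succ i)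
    calc f i ≤ A * S ^ ((n : ℝ) - p + ε) / (c * S ^ ((n : ℝ) - p)) :=
          ENNReal.div_le_div ((varCap_mono (inter_subset_inter_left _ inter_subset_right)).trans
            (hcap (i + 1) (by omega))) (hden i)
      _ = A / c * S ^ ε := by
          rw [ENNReal.rpow_add _ _ (hσ0 i) ENNReal.ofReal_ne_top, mul_left_comm, mul_comm c,
            ENNReal.mul_div_mul_left _ _ (hσp i) (hσt i), mul_comm A, mul_div_assoc, mul_comm]
      _ ≤ A / c * θ ^ i := mul_le_mul_right hSε _
  rw [← (ENNReal.summable (f := fun i => f (i + N))).sum_add_tsum_nat_add']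
  refine ENNReal.add_lt_top.2 ⟨ENNReal.sum_lt_top.2 fun i _ => (hfin i).lt_top, ?_⟩
  calc ∑' i, f (i + N) ≤ ∑' i, A / c * θ ^ i := ENNReal.tsum_le_tsum fun i =>
        (hterm (i + N) (by omega)).trans
          (mul_le_mul_right (pow_le_pow_right_of_le_one' hθ1.le (Nat.le_add_right i N)) _)
    _ = A / c * (1 - θ)⁻¹ := by rw [ENNReal.tsum_mul_left, ENNReal.tsum_geometric]
    _ < ⊤ := (ENNReal.mul_ne_top (ENNReal.div_ne_top hA hc0)
        (ENNReal.inv_ne_top.2 (tsub_pos_of_lt hθ1).ne')).lt_top
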